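/- Suppose S is smooth. Then there exists a nonempty Zariski open subset O of ℂ^{(n−p)×n} such that for every a ∈ O (all submatrices a^{(i)} having maximal rank n−p−i+1) and every 1 ≤ i ≤ n−p, the generic polar varieties W_{K(\underline{a^{(i)}})}(S) and W_{\bar K(\bar{a^{(i)}})}(S) are empty or normal Cohen–Macaulay subvarieties of S of pure codimension i. -/

import Mathlib

open MvPolynomial

noncomputable section

/-- The Zariski closure of a subset of the affine space `σ → ℂ`. -/
def zcl {σ : Type} (T : Set (σ → ℂ)) : Set (σ → ℂ) :=
  MvPolynomial.zeroLocus ℂ (MvPolynomial.vanishingIdeal ℂ T)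

/-- Zariski open subsets of the affine space `σ → ℂ`. -/
def ZOpen {σ : Type} (U : Set (σ → ℂ)) : Prop :=
  ∃ I : Ideal (MvPolynomial σ ℂ), U = {x | ∃ f ∈ I, MvPolynomial.eval x f ≠ 0}

/-- Zariski open subsets of the space of `m × n` complex matrices. -/
def ZOpenMat {m n : ℕ} (U : Set (Matrix (Fin m) (Fin n) ℂ)) : Prop :=
  ∃ I : Ideal (MvPolynomial (Fin m × Fin n) ℂ),
    U = {a | ∃ f ∈ I, MvPolynomial.eval (fun q => a q.1 q.2) f ≠ 0}

/-- `T` is of pure dimension `d`: every irreducible component of (the Zariski closure of) `T`,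
i.e. every minimal prime over its vanishing ideal, has coordinate ring of Krull dimension `d`. -/
def IsPureDim {σ : Type} (T : Set (σ → ℂ)) (d : ℕ) : Prop :=
  ∀ P ∈ (MvPolynomial.vanishingIdeal ℂ T).minimalPrimes,
    ringKrullDim (MvPolynomial σ ℂ ⧸ P) = (d : WithBot (WithTop ℕ))

/-- The Zariski tangent space at a point `x` of (the Zariski closure of) a subset `T`
of affine space: the common kernel of the differentials at `x` of all polynomials
vanishing on `T`. -/
def tangentAt {σ : Type} [Fintype σ] [DecidableEq σ] (T : Set (σ → ℂ)) (x : σ → ℂ) :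
    Submodule ℂ (σ → ℂ) :=
  ⨅ (f : MvPolynomial σ ℂ) (_ : f ∈ MvPolynomial.vanishingIdeal ℂ T),
    LinearMap.ker
      (∑ l, MvPolynomial.eval x (MvPolynomial.pderiv l f) •
        (LinearMap.proj l : (σ → ℂ) →ₗ[ℂ] ℂ))

/-- `rs` is a regular sequence in the commutative ring `R`. -/
def IsRegSeq {R : Type*} [CommRing R] (rs : List R) : Prop :=
  Ideal.span {x | x ∈ rs} ≠ ⊤ ∧
  ∀ j, j < rs.length → ∀ b : R,
    rs.getD j 0 * b ∈ Ideal.span {x | x ∈ rs.take j} →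
    b ∈ Ideal.span {x | x ∈ rs.take j}

/-- The common zero set in `ℂⁿ` of polynomials `F₁, …, F_p ∈ ℚ[X₁, …, Xₙ]`. -/
def zeroSetC {n p : ℕ} (F : Fin p → MvPolynomial (Fin n) ℚ) : Set (Fin n → ℂ) :=
  {x | ∀ k, MvPolynomial.aeval x (F k) = 0}

/-- The Jacobian matrix `[∂F_k/∂X_l]` evaluated at `x ∈ ℂⁿ`. -/
def jacC {n p : ℕ} (F : Fin p → MvPolynomial (Fin n) ℚ) (x : Fin n → ℂ) :
    Matrix (Fin p) (Fin n) ℂ :=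
  Matrix.of fun k l => MvPolynomial.aeval x (MvPolynomial.pderiv l (F k))

/-- The set of regular points of `S = {F₁ = 0, …, F_p = 0}`: points of `S` where the
Jacobian has maximal rank `p`. -/
def SregC {n p : ℕ} (F : Fin p → MvPolynomial (Fin n) ℚ) : Set (Fin n → ℂ) :=
  {x | x ∈ zeroSetC F ∧ (jacC F x).rank = p}

/-- The classic polar variety: the Zariski closure of the locus of regular points of `S`
where the matrix obtained by appending the rows of `a` to the Jacobian has rank at
most `r` (i.e. where all `(r+1)`-minors vanish). -/
def Wclassic {n p m : ℕ} (F : Fin p → MvPolynomial (Fin n) ℚ)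
    (a : Matrix (Fin m) (Fin n) ℂ) (r : ℕ) : Set (Fin n → ℂ) :=
  zcl {x | x ∈ SregC F ∧ (Matrix.fromRows (jacC F x) a).rank ≤ r}

/-- The dual polar variety: as `Wclassic`, with appended rows `(a_{k,1} - X₁, …, a_{k,n} - Xₙ)`. -/
def Wdual {n p m : ℕ} (F : Fin p → MvPolynomial (Fin n) ℚ)
    (a : Matrix (Fin m) (Fin n) ℂ) (r : ℕ) : Set (Fin n → ℂ) :=
  zcl {x | x ∈ SregC F ∧
    (Matrix.fromRows (jacC F x) (Matrix.of fun k l => a k l - x l)).rank ≤ r}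

/-- `F₁, …, F_p` generate the full vanishing ideal of their zero set (over `ℂ`);
this encodes that `(F₁, …, F_p)` is reduced (radical) and the ideal of definition of `S`. -/
def idealOfDef {n p : ℕ} (F : Fin p → MvPolynomial (Fin n) ℚ) : Prop :=
  MvPolynomial.vanishingIdeal ℂ (zeroSetC F) =
    Ideal.span (Set.range fun k => MvPolynomial.map (algebraMap ℚ ℂ) (F k))

/-- The submatrix of the first `m` rows of a matrix. -/
def firstRows {N n' m : ℕ} (a : Matrix (Fin N) (Fin n') ℂ) (h : m ≤ N) :
    Matrix (Fin m) (Fin n') ℂ :=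
  Matrix.of fun k l => a (Fin.castLE h k) l

/-- The matrix obtained by deleting row `h`. -/
def rowErase {m n' : ℕ} (a : Matrix (Fin (m + 1)) (Fin n') ℂ) (h : Fin (m + 1)) :
    Matrix (Fin m) (Fin n') ℂ :=
  Matrix.of fun k l => a (h.succAbove k) l

/-- The real trace `S_ℝ := S ∩ ℝⁿ`, as a subset of Euclidean space. -/
def SR {n p : ℕ} (F : Fin p → MvPolynomial (Fin n) ℚ) : Set (EuclideanSpace ℝ (Fin n)) :=
  {x | (fun j => (x j : ℂ)) ∈ zeroSetC F}

/-- `C` is a connected component of `T`. -/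
def IsConnCompOf {α : Type*} [TopologicalSpace α] (C T : Set α) : Prop :=
  C.Nonempty ∧ C ⊆ T ∧ IsPreconnected C ∧
    ∀ D, C ⊆ D → D ⊆ T → IsPreconnected D → D = C

end

/-- A (Noetherian) local ring is Cohen–Macaulay iff it admits a regular sequence of
nonunits whose length equals its Krull dimension. -/
def IsCMLocalRing (R : Type) [CommRing R] : Prop :=
  ∃ rs : List R, (∀ r ∈ rs, ¬IsUnit r) ∧ IsRegSeq rs ∧
    (rs.length : WithBot (WithTop ℕ)) = ringKrullDim R

/-- A commutative ring is Cohen–Macaulay iff all its localizations at maximal ideals are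
Cohen–Macaulay local rings. -/
def IsCMRing (R : Type) [CommRing R] : Prop :=
  ∀ P : Ideal R, ∀ _hP : P.IsPrime, P.IsMaximal → IsCMLocalRing (Localization.AtPrime P)

section CodimDepthOfExt
open CategoryTheory Abelian

/-- The grade inequality `grade (Q, N) ≥ height Q - c` for all primes `Q` of `T`, expressed by the
vanishing of `Ext`; for `N` a local quotient of codimension `c` of a Cohen–Macaulay ring it says
that `N` is Cohen–Macaulay. -/
def CodimDepth (T : Type) [CommRing T] (c : ℕ) (N : Type) [AddCommGroup N] [Module T N] : Prop :=
  ∀ Q : Ideal T, Q.IsPrime → ∀ j : ℕ, ((j + c : ℕ) : ℕ∞) < Q.height →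
    Subsingleton (Ext (ModuleCat.of T (T ⧸ Q)) (ModuleCat.of T N) j)

namespace CodimDepth
variable {T : Type} [CommRing T] {A B C : Type} [AddCommGroup A] [Module T A]
  [AddCommGroup B] [Module T B] [AddCommGroup C] [Module T C]

lemma congr {c : ℕ} (e : A ≃ₗ[T] B) (h : CodimDepth T c A) : CodimDepth T c B := by
  intro Q hQ j hj
  have := h Q hQ j hj
  exact AddCommGrpCat.subsingleton_of_isZero
    ((AddCommGrpCat.isZero_of_iff_subsingleton.mpr this).of_iso
      ((extFunctorObj (ModuleCat.of T (T ⧸ Q)) j).mapIso e.toModuleIso).symm)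

lemma of_subsingleton [Subsingleton A] (c : ℕ) : CodimDepth T c A := by
  intro Q hQ j hj
  have : Limits.IsZero (ModuleCat.of T A) := ModuleCat.isZero_of_subsingleton _
  exact AddCommGrpCat.subsingleton_of_isZero
    ((extFunctorObj (ModuleCat.of T (T ⧸ Q)) j).map_isZero this)

lemma of_exact_left {c : ℕ} (f : A →ₗ[T] B) (g : B →ₗ[T] C) (hf : Function.Injective f)
    (hfg : Function.Exact f g) (hg : Function.Surjective g)
    (hB : CodimDepth T c B) (hC : CodimDepth T (c + 1) C) : CodimDepth T c A := by
  have hS := ModuleCat.shortComplex_shortExact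
    (ModuleCat.shortComplexOfCompEqZero f g hfg.linearMap_comp_eq_zero) hfg hf hg
  intro Q hQ j hj
  have hB' := hB Q hQ j hj
  refine subsingleton_of_forall_eq 0 fun x => ?_
  have hx : x.comp (Ext.mk₀ (ModuleCat.ofHom f)) (add_zero j) = 0 :=
    @Subsingleton.elim _ hB' _ _
  cases j with
  | zero =>
    have := hS.mono_f
    refine Ext.postcomp_mk₀_injective_of_mono _ (ModuleCat.shortComplexOfCompEqZero f g
      hfg.linearMap_comp_eq_zero).f ?_
    simpa using hx
  | succ j =>
    obtain ⟨y, rfl⟩ := Ext.covariant_sequence_exact₁ _ hS x hx rfl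
    have hC' := hC Q hQ j (lt_of_le_of_lt (by norm_cast; omega) hj)
    have hy : y = 0 := @Subsingleton.elim _ hC' _ _
    simp [hy]

lemma of_exact_right {c : ℕ} (f : A →ₗ[T] B) (g : B →ₗ[T] C) (hf : Function.Injective f)
    (hfg : Function.Exact f g) (hg : Function.Surjective g)
    (hA : CodimDepth T c A) (hB : CodimDepth T c B) : CodimDepth T (c + 1) C := by
  have hS := ModuleCat.shortComplex_shortExact
    (ModuleCat.shortComplexOfCompEqZero f g hfg.linearMap_comp_eq_zero) hfg hf hg
  intro Q hQ j hj
  have hA' := hA Q hQ (j + 1) (lt_of_le_of_lt (by norm_cast; omega) hj)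
  have hB' := hB Q hQ j (lt_of_le_of_lt (by norm_cast; omega) hj)
  refine subsingleton_of_forall_eq 0 fun x => ?_
  obtain ⟨y, rfl⟩ := Ext.covariant_sequence_exact₃ _ hS x rfl (@Subsingleton.elim _ hA' _ _)
  have hy : y = 0 := @Subsingleton.elim _ hB' _ _
  simp [hy]

lemma height_le_of_isAssociatedPrime [IsNoetherianRing T] {c : ℕ} (h : CodimDepth T c A)
    {Q : Ideal T} (hQ : IsAssociatedPrime Q A) : Q.height ≤ c := by
  by_contra hlt
  have hQp := hQ.isPrime
  have h0 := h Q hQp 0 (by simpa using hlt)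
  have h1 : Subsingleton (ModuleCat.of T (T ⧸ Q) →ₗ[T] ModuleCat.of T A) :=
    (Ext.addEquiv₀.trans ModuleCat.homAddEquiv).symm.subsingleton
  obtain ⟨f, hf⟩ := (isAssociatedPrime_iff_exists_injective_linearMap Q A).mp hQ |>.2
  have : f = 0 := @Subsingleton.elim _ h1 f 0
  have : (1 : T ⧸ Q) = 0 := hf (by simp [this])
  exact one_ne_zero this

lemma quotient_sup_span_singleton {c : ℕ} {I : Ideal T} (h : CodimDepth T c (T ⧸ I)) {x : T}
    (hx : ∀ y, x * y ∈ I → y ∈ I) : CodimDepth T (c + 1) (T ⧸ (I ⊔ Ideal.span {x})) := by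
  refine of_exact_right (A := T ⧸ I) (B := T ⧸ I)
    (LinearMap.lsmul T (T ⧸ I) x) (Submodule.factor le_sup_left) ?_ ?_
    (Submodule.factor_surjective _) h h
  · rw [injective_iff_map_eq_zero]
    intro y
    obtain ⟨y, rfl⟩ := Ideal.Quotient.mk_surjective y
    intro hy
    rw [Ideal.Quotient.eq_zero_iff_mem]
    exact hx y (Ideal.Quotient.eq_zero_iff_mem.mp hy)
  · intro y
    obtain ⟨y, rfl⟩ := Ideal.Quotient.mk_surjective y
    constructor
    · intro hy
      have hy' : y ∈ I ⊔ Ideal.span {x} := Ideal.Quotient.eq_zero_iff_mem.mp hy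
      obtain ⟨b, hb, z, hz, rfl⟩ := Submodule.mem_sup.mp hy'
      obtain ⟨w, rfl⟩ := Ideal.mem_span_singleton'.mp hz
      refine ⟨Ideal.Quotient.mk I w, ?_⟩
      refine (Ideal.Quotient.eq (x := x * w)).mpr ?_
      rw [← neg_mem_iff]; convert hb using 1; ring
    · rintro ⟨w, hw⟩
      obtain ⟨w, rfl⟩ := Ideal.Quotient.mk_surjective w
      have hw' : x * w - y ∈ I := (Ideal.Quotient.eq (x := x * w)).mp hw
      refine Ideal.Quotient.eq_zero_iff_mem.mpr ?_
      have := Submodule.sub_mem _ (Submodule.mem_sup_right (S := I)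
        (Ideal.mul_mem_right w _ (Ideal.mem_span_singleton_self x))) (Submodule.mem_sup_left hw')
      simpa using this
end CodimDepth

lemma exact_subtype_factor {T : Type} [CommRing T] (I J : Ideal T) :
    Function.Exact (Submodule.map (Submodule.mkQ I) J).subtype
      (Submodule.factor (le_sup_left : I ≤ I ⊔ J)) := by
  intro y
  obtain ⟨y, rfl⟩ := Submodule.mkQ_surjective _ y
  have h1 : Submodule.factor (le_sup_left : I ≤ I ⊔ J) (I.mkQ y) = 0 ↔ y ∈ I ⊔ J := by
    exact Ideal.Quotient.eq_zero_iff_mem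
  rw [h1, ← Submodule.comap_map_mkQ, Submodule.mem_comap]
  exact ⟨fun h => ⟨⟨_, h⟩, rfl⟩, by rintro ⟨z, hz⟩; rw [← hz]; exact z.2⟩

lemma exists_smul_notMem_of_finite {T ι : Type} [CommRing T] [Algebra ℂ T] [Fintype ι]
    (u : ι → T) (A : Set (Ideal T)) (hA : A.Finite) (hu : ∀ Q ∈ A, ∃ i, u i ∉ Q)
    (B : Set (Ideal T)) (hB : B.Finite) (v : ι → T) (hv : ∀ Q ∈ B, ∃ i, v i ∉ Q) :
    ∃ a : ι → ℂ, (∀ Q ∈ A, ∑ i, a i • u i ∉ Q) ∧ ∀ Q ∈ B, ∑ i, a i • v i ∉ Q := by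
  classical
  let φ (w : ι → T) (Q : Ideal T) : Subspace ℂ (ι → ℂ) :=
    (Q.restrictScalars ℂ).comap (Fintype.linearCombination ℂ w)
  have hφ (w : ι → T) (Q : Ideal T) (h : ∃ i, w i ∉ Q) : φ w Q ≠ ⊤ := by
    obtain ⟨i, hi⟩ := h
    intro htop
    have : Pi.single i 1 ∈ φ w Q := htop ▸ Submodule.mem_top
    simp [φ] at this
    exact hi this
  let s : Finset (Subspace ℂ (ι → ℂ)) := hA.toFinset.image (φ u) ∪ hB.toFinset.image (φ v)
  have hs : ⋃ p ∈ s, (p : Set (ι → ℂ)) ≠ Set.univ := by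
    apply Subspace.biUnion_ne_univ_of_top_notMem
    simp only [s, Finset.mem_union, Finset.mem_image, Set.Finite.mem_toFinset]
    rintro (⟨Q, hQ, h⟩ | ⟨Q, hQ, h⟩)
    · exact hφ _ _ (hu Q hQ) h
    · exact hφ _ _ (hv Q hQ) h
  obtain ⟨a, ha⟩ := (Set.ne_univ_iff_exists_notMem _).mp hs
  simp only [s, Finset.mem_union, Finset.mem_image, Set.Finite.mem_toFinset, Set.mem_iUnion,
    not_exists] at ha
  refine ⟨a, fun Q hQ h => ha _ (Or.inl ⟨Q, hQ, rfl⟩) ?_,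
    fun Q hQ h => ha _ (Or.inr ⟨Q, hQ, rfl⟩) ?_⟩
  · simpa [φ, Fintype.linearCombination_apply] using h
  · simpa [φ, Fintype.linearCombination_apply] using h

lemma mem_of_mul_mem_of_notMem_associatedPrimes {T : Type} [CommRing T] [IsNoetherianRing T]
    {I : Ideal T} {x : T} (hx : ∀ Q ∈ associatedPrimes T (T ⧸ I), x ∉ Q) {y : T}
    (h : x * y ∈ I) : y ∈ I := by
  by_contra hy
  have h2 := biUnion_associatedPrimes_eq_zero_divisors T (T ⧸ I)
  have h3 : x ∈ ⋃ p ∈ associatedPrimes T (T ⧸ I), (p : Set T) := by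
    rw [h2]
    exact ⟨Ideal.Quotient.mk I y, by rwa [Ne, Ideal.Quotient.eq_zero_iff_mem],
      Ideal.Quotient.eq_zero_iff_mem.mpr h⟩
  simp only [Set.mem_iUnion] at h3
  obtain ⟨Q, hQ, h4⟩ := h3
  exact hx Q hQ h4

lemma le_of_isAssociatedPrime_quotient {T : Type} [CommRing T]
    {I Q : Ideal T} (h : IsAssociatedPrime Q (T ⧸ I)) : I ≤ Q := by
  simpa [Submodule.annihilator_top, Ideal.annihilator_quotient] using h.annihilator_le

lemma CodimDepth.of_proportional {T ι : Type} [CommRing T] [IsNoetherianRing T] [Algebra ℂ T]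
    [Fintype ι] {c : ℕ} (u v : ι → T) (I : Ideal T) (hrel : ∀ i j, u i * v j - u j * v i ∈ I)
    (hI : CodimDepth T c (T ⧸ I))
    (hV : CodimDepth T (c + 1) (T ⧸ (I ⊔ Ideal.span (Set.range v))))
    (hu : ∀ Q : Ideal T, Q.IsPrime → I ≤ Q → (∀ i, u i ∈ Q) → ((c + 1 : ℕ) : ℕ∞) ≤ Q.height)
    (hv : ∀ Q : Ideal T, Q.IsPrime → I ≤ Q → (∀ i, v i ∈ Q) → ((c + 1 : ℕ) : ℕ∞) ≤ Q.height) :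
    CodimDepth T (c + 1) (T ⧸ (I ⊔ Ideal.span (Set.range u))) := by
  have key (w : ι → T) (hw : ∀ Q : Ideal T, Q.IsPrime → I ≤ Q → (∀ i, w i ∈ Q) →
      ((c + 1 : ℕ) : ℕ∞) ≤ Q.height) : ∀ Q ∈ associatedPrimes T (T ⧸ I), ∃ i, w i ∉ Q := by
    intro Q hQ
    by_contra! h
    have h1 := hw Q hQ.isPrime (le_of_isAssociatedPrime_quotient hQ) h
    have h2 := hI.height_le_of_isAssociatedPrime hQ
    exact absurd (h1.trans h2) (by norm_cast; omega)
  have hfin := associatedPrimes.finite T (T ⧸ I)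
  obtain ⟨a, ha1, ha2⟩ := exists_smul_notMem_of_finite u _ hfin (key u hu) _ hfin v (key v hv)
  set u0 := ∑ i, a i • u i
  set v0 := ∑ i, a i • v i
  have hrel0 (j : ι) : u0 * v j - v0 * u j ∈ I := by
    have : u0 * v j - v0 * u j = ∑ i, a i • (u i * v j - u j * v i) := by
      simp only [u0, v0, Finset.sum_mul, ← Finset.sum_sub_distrib]
      refine Finset.sum_congr rfl fun i _ => ?_
      rw [smul_sub, smul_mul_assoc, smul_mul_assoc, mul_comm (v i)]
    rw [this]
    exact Submodule.sum_mem _ fun i _ => by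
      rw [Algebra.smul_def]; exact Ideal.mul_mem_left _ _ (hrel i j)
  have inj (x : T) (hx : ∀ Q ∈ associatedPrimes T (T ⧸ I), x ∉ Q) :
      Function.Injective (LinearMap.lsmul T (T ⧸ I) x) := by
    rw [injective_iff_map_eq_zero]
    intro y
    obtain ⟨y, rfl⟩ := Ideal.Quotient.mk_surjective y
    intro hy
    rw [Ideal.Quotient.eq_zero_iff_mem]
    exact mem_of_mul_mem_of_notMem_associatedPrimes hx (Ideal.Quotient.eq_zero_iff_mem.mp hy)
  set U := Submodule.map (Submodule.mkQ I) (Ideal.span (Set.range u))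
  set V := Submodule.map (Submodule.mkQ I) (Ideal.span (Set.range v))
  have hUV : U.map (LinearMap.lsmul T (T ⧸ I) v0) = V.map (LinearMap.lsmul T (T ⧸ I) u0) := by
    simp only [U, V, Submodule.map_span, ← Set.range_comp]
    congr 2
    ext j
    exact ((Ideal.Quotient.eq (x := u0 * v j) (y := v0 * u j)).mpr (hrel0 j)).symm
  have e : V ≃ₗ[T] U :=
    (Submodule.equivMapOfInjective _ (inj u0 ha1) V).trans
      ((LinearEquiv.ofEq _ _ hUV.symm).trans
        (Submodule.equivMapOfInjective _ (inj v0 ha2) U).symm)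
  have hV' : CodimDepth T c V := CodimDepth.of_exact_left V.subtype (Submodule.factor le_sup_left)
    V.injective_subtype (exact_subtype_factor _ _) (Submodule.factor_surjective _) hI hV
  exact CodimDepth.of_exact_right U.subtype (Submodule.factor le_sup_left)
    U.injective_subtype (exact_subtype_factor _ _) (Submodule.factor_surjective _)
    (hV'.congr e) hI

section Grade
open RingTheory.Sequence

lemma isWeaklyRegular_self_iff {T : Type} [CommRing T] (rs : List T) :
    IsWeaklyRegular T rs ↔ ∀ i (h : i < rs.length), ∀ b, rs[i] * b ∈ Ideal.ofList (rs.take i) →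
      b ∈ Ideal.ofList (rs.take i) := by
  rw [isWeaklyRegular_iff]
  refine forall₂_congr fun i h => ?_
  have : Ideal.ofList (rs.take i) • (⊤ : Submodule T T) = Ideal.ofList (rs.take i) := by
    rw [smul_eq_mul, Ideal.mul_top]
  rw [this, isSMulRegular_iff_right_eq_zero_of_smul]
  constructor
  · intro H b hb
    exact Ideal.Quotient.eq_zero_iff_mem.mp (H _ (Ideal.Quotient.eq_zero_iff_mem.mpr hb))
  · intro H b
    obtain ⟨b, rfl⟩ := Ideal.Quotient.mk_surjective b
    intro hb
    exact Ideal.Quotient.eq_zero_iff_mem.mpr (H _ (Ideal.Quotient.eq_zero_iff_mem.mp hb))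

lemma isWeaklyRegular_take {T : Type} [CommRing T] {rs : List T} (h : IsWeaklyRegular T rs)
    (k : ℕ) : IsWeaklyRegular T (rs.take k) := by
  rw [← List.take_append_drop k rs, isWeaklyRegular_append_iff] at h
  exact h.1

/-- Every prime ideal contains a weakly regular sequence of length its height. -/
def HasGradeEqHeight (T : Type) [CommRing T] : Prop :=
  ∀ P : Ideal T, P.IsPrime → ∃ rs : List T, P.height ≤ rs.length ∧ (∀ r ∈ rs, r ∈ P) ∧
    IsWeaklyRegular T rs

lemma HasGradeEqHeight.codimDepth {T : Type} [CommRing T] [IsNoetherianRing T]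
    (h : HasGradeEqHeight T) : CodimDepth T 0 T := by
  intro Q hQ j hj
  obtain ⟨rs, h1, h2, h3⟩ := h Q hQ
  have hlt : Q • (⊤ : Submodule T T) < ⊤ := by
    rw [smul_eq_mul, Ideal.mul_top]; exact hQ.ne_top.lt_top
  have hle : Ideal.ofList rs ≤ Q := Ideal.span_le.mpr h2
  refine ModuleCat.subsingleton_ext_of_exists_isRegular Q (ModuleCat.of T (T ⧸ Q)) ?_
    (ModuleCat.of T T) hlt rs h2 ⟨h3, ?_⟩ j ?_
  · rw [Module.support_eq_zeroLocus, Ideal.annihilator_quotient]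
  · intro heq
    exact hlt.not_ge (heq.trans_le (Submodule.smul_mono_left hle))
  · exact_mod_cast hj.trans_le h1

lemma ofList_take_succ {T : Type} [CommRing T] (rs : List T) (i : ℕ) (h : i < rs.length) :
    Ideal.ofList (rs.take (i + 1)) = Ideal.ofList (rs.take i) ⊔ Ideal.span {rs[i]} := by
  rw [List.take_succ_eq_append_getElem h, Ideal.ofList_append, Ideal.ofList_singleton]

lemma CodimDepth.quotient_ofList {T : Type} [CommRing T] (h : CodimDepth T 0 T)
    {rs : List T} (hrs : IsWeaklyRegular T rs) :
    CodimDepth T rs.length (T ⧸ Ideal.ofList rs) := by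
  rw [isWeaklyRegular_self_iff] at hrs
  have key : ∀ i ≤ rs.length, CodimDepth T i (T ⧸ Ideal.ofList (rs.take i)) := by
    intro i
    induction i with
    | zero =>
      intro _
      exact h.congr (Submodule.quotEquivOfEqBot _ (by simp)).symm
    | succ i ih =>
      intro hi
      rw [ofList_take_succ rs i (by omega)]
      exact (ih (by omega)).quotient_sup_span_singleton (hrs i (by omega))
  have := key rs.length le_rfl
  rwa [List.take_length] at this

lemma HasGradeEqHeight.of_field (K : Type) [Field K] : HasGradeEqHeight K := by
  intro P hP
  refine ⟨[], ?_, by simp, by simp⟩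
  have : P = ⊥ := (Ideal.eq_bot_or_top P).resolve_right hP.ne_top
  simp [this]

lemma HasGradeEqHeight.of_isLocalization {T S : Type} [CommRing T] [CommRing S] [Algebra T S]
    (M : Submonoid T) [IsLocalization M S] (h : HasGradeEqHeight T) : HasGradeEqHeight S := by
  intro P hP
  obtain ⟨rs, h1, h2, h3⟩ := h (P.under T) inferInstance
  refine ⟨rs.map (algebraMap T S), ?_, ?_, h3.of_isLocalization S M⟩
  · rwa [List.length_map, ← IsLocalization.height_under M P]
  · intro r hr
    obtain ⟨t, ht, rfl⟩ := List.mem_map.mp hr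
    exact h2 t ht

lemma HasGradeEqHeight.of_ringEquiv {T S : Type} [CommRing T] [CommRing S] (e : T ≃+* S)
    (h : HasGradeEqHeight T) : HasGradeEqHeight S := by
  let := e.toRingHom.toAlgebra
  have : IsLocalization (⊥ : Submonoid T) S :=
    IsLocalization.of_le_isUnit_of_bijective
      (by rw [Algebra.algebraMapSubmonoid, Submonoid.map_bot]; exact bot_le) e.bijective
  exact h.of_isLocalization ⊥

lemma Polynomial.height_le_one_of_under_eq_bot {D : Type} [CommRing D] [IsDomain D]
    (P : Ideal (Polynomial D)) [P.IsPrime] (hP : P.under D = ⊥) : P.height ≤ 1 := by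
  let K := FractionRing D
  let := Polynomial.algebra D K
  have := Polynomial.isLocalization (nonZeroDivisors D) K
  have hd : Disjoint (((nonZeroDivisors D).map (Polynomial.C : D →+* Polynomial D) :
      Submonoid (Polynomial D)) : Set (Polynomial D)) (P : Set (Polynomial D)) := by
    rw [Set.disjoint_left]
    rintro _ ⟨d, hd, rfl⟩ hP'
    have : d ∈ P.under D := hP'
    rw [hP] at this
    exact nonZeroDivisors.ne_zero hd this
  rw [← IsLocalization.height_map_of_disjoint (S := Polynomial K) _ P hd]
  have hp := IsLocalization.isPrime_of_isPrime_disjoint _ (Polynomial K) P ‹_› hd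
  have := Ideal.height_le_ringKrullDim_of_ne_top hp.ne_top
  rw [Polynomial.ringKrullDim_of_isNoetherianRing, ringKrullDim_eq_zero_of_field, zero_add] at this
  exact_mod_cast this

lemma HasGradeEqHeight.polynomial {B : Type} [CommRing B] [IsNoetherianRing B]
    (h : HasGradeEqHeight B) : HasGradeEqHeight (Polynomial B) := by
  intro P hP
  set p := P.under B with hpdef
  have hp : p.IsPrime := inferInstance
  have : P.LiesOver p := ⟨rfl⟩
  obtain ⟨rs, h1, h2, h3⟩ := h p hp
  obtain ⟨k, hk⟩ := ENat.ne_top_iff_exists.mp (Ideal.height_ne_top hp.ne_top)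
  have hk1 : k ≤ rs.length := by rw [← hk] at h1; exact_mod_cast h1
  have hlen : (rs.take k).length = k := by simp [hk1]
  replace h2 : ∀ r ∈ rs.take k, r ∈ p := fun r hr => h2 r (List.mem_of_mem_take hr)
  replace h3 := isWeaklyRegular_take h3 k
  clear h1 hk1
  generalize rs.take k = rs at hlen h2 h3
  have hht := Ideal.height_le_height_add_of_liesOver p P
  have h3' : IsWeaklyRegular (Polynomial B) (rs.map Polynomial.C) := h3.of_flat
  have h2' : ∀ r ∈ rs.map Polynomial.C, r ∈ P := by
    intro r hr
    obtain ⟨t, ht, rfl⟩ := List.mem_map.mp hr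
    exact h2 t ht
  have hmap : p.map (algebraMap B (Polynomial B)) ≤ P := Ideal.map_le_iff_le_comap.mpr le_rfl
  have hnt : Nontrivial (Polynomial B ⧸ p.map (algebraMap B (Polynomial B))) :=
    Ideal.Quotient.nontrivial_iff.mpr fun h => hP.ne_top (top_le_iff.mp (h.symm.trans_le hmap))
  by_cases hPp : P ≤ p.map Polynomial.C
  · refine ⟨_, hht.trans ?_, h2', h3'⟩
    have : P.map (Ideal.Quotient.mk (p.map (algebraMap B (Polynomial B)))) = ⊥ := by
      rw [Ideal.map_eq_bot_iff_le_ker, Ideal.mk_ker]; exact hPp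
    rw [this, Ideal.height_bot, ← hk]
    simp [hlen]
  · have hass : ∀ q ∈ associatedPrimes B (B ⧸ Ideal.ofList rs), ¬ P ≤ q.map Polynomial.C := by
      intro q hq hle
      have hqh := (h.codimDepth.quotient_ofList h3).height_le_of_isAssociatedPrime hq
      have hpq : p ≤ q := by
        intro x hx
        have := Ideal.mem_map_C_iff.mp (hle (show Polynomial.C x ∈ P from hx)) 0
        simpa using this
      have := Ideal.eq_of_le_of_height_le p hpq (by rw [← hk, ← hlen]; exact hqh)
      exact hPp (this ▸ hle)
    have hfin := associatedPrimes.finite B (B ⧸ Ideal.ofList rs)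
    have hav := (not_congr (Ideal.subset_union_prime_finite hfin (f := fun q => q.map Polynomial.C)
      0 0 (fun q hq _ _ => by
        have := IsAssociatedPrime.isPrime hq
        exact Ideal.isPrime_map_C_of_isPrime) (I := P))).mpr (by
          rintro ⟨q, hq, hle⟩; exact hass q hq hle)
    obtain ⟨g, hgP, hg⟩ := Set.not_subset.mp hav
    simp only [Set.mem_iUnion, not_exists] at hg
    refine ⟨rs.map Polynomial.C ++ [g], ?_, ?_, ?_⟩
    · refine hht.trans ?_
      rw [List.length_append, List.length_map, hlen, List.length_singleton, Nat.cast_add, hk]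
      gcongr
      let e : (Polynomial B ⧸ (p.map (algebraMap B (Polynomial B)))) ≃+* Polynomial (B ⧸ p) :=
        (Ideal.polynomialQuotientEquivQuotientPolynomial p).symm
      have hP1 : (P.map (Ideal.Quotient.mk (p.map (algebraMap B (Polynomial B))))).IsPrime :=
        Ideal.map_isPrime_of_surjective Ideal.Quotient.mk_surjective (by rwa [Ideal.mk_ker])
      rw [← RingEquiv.height_comap e.symm]
      refine Polynomial.height_le_one_of_under_eq_bot _ ?_
      rw [eq_bot_iff]
      intro x hx
      obtain ⟨x, rfl⟩ := Ideal.Quotient.mk_surjective x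
      have hx' : e.symm (Polynomial.C (Ideal.Quotient.mk p x)) ∈
        P.map (Ideal.Quotient.mk (p.map (algebraMap B (Polynomial B)))) := hx
      have hx2 : e.symm (Polynomial.C (Ideal.Quotient.mk p x)) =
          Ideal.Quotient.mk (p.map (algebraMap B (Polynomial B))) (Polynomial.C x) := by
        rw [← Polynomial.map_C]
        exact Ideal.polynomialQuotientEquivQuotientPolynomial_map_mk p (Polynomial.C x)
      rw [hx2, Ideal.mem_quotient_iff_mem hmap] at hx'
      exact Ideal.Quotient.eq_zero_iff_mem.mpr hx'
    · intro r hr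
      rcases List.mem_append.mp hr with hr | hr
      · exact h2' r hr
      · rw [List.mem_singleton.mp hr]; exact hgP
    · rw [isWeaklyRegular_append_iff]
      refine ⟨h3', ?_⟩
      have hI : Ideal.ofList (rs.map Polynomial.C) • (⊤ : Submodule (Polynomial B) (Polynomial B)) =
          (Ideal.ofList rs).map Polynomial.C := by
        rw [smul_eq_mul, Ideal.mul_top, Ideal.map_ofList]
      rw [isWeaklyRegular_singleton_iff, hI, isSMulRegular_iff_right_eq_zero_of_smul]
      intro f
      obtain ⟨f, rfl⟩ := Ideal.Quotient.mk_surjective f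
      intro hf
      have hgf : g * f ∈ (Ideal.ofList rs).map Polynomial.C := Ideal.Quotient.eq_zero_iff_mem.mp hf
      refine Ideal.Quotient.eq_zero_iff_mem.mpr ?_
      have hmem (u : Polynomial B) : u ∈ (Ideal.ofList rs).map Polynomial.C ↔
          u.map (Ideal.Quotient.mk (Ideal.ofList rs)) = 0 := by
        rw [Ideal.mem_map_C_iff, Polynomial.ext_iff]
        simp [Ideal.Quotient.eq_zero_iff_mem]
      rw [hmem, Polynomial.map_mul] at hgf
      rw [hmem]
      by_contra hne
      have hnz : g.map (Ideal.Quotient.mk (Ideal.ofList rs)) ∉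
          nonZeroDivisors (Polynomial (B ⧸ Ideal.ofList rs)) := fun hmem' =>
        hne ((mem_nonZeroDivisors_iff_right.mp hmem') _ (by rw [mul_comm]; exact hgf))
      obtain ⟨a, ha, hag⟩ := Polynomial.notMem_nonZeroDivisors_iff.mp hnz
      obtain ⟨q, hq, hle⟩ := exists_le_isAssociatedPrime_of_isNoetherianRing B a ha
      refine hg q hq ?_
      rw [SetLike.mem_coe, Ideal.mem_map_C_iff]
      intro m
      apply hle
      have := congrArg (fun u => Polynomial.coeff u m) hag
      simp only [Polynomial.coeff_smul, Polynomial.coeff_map, Polynomial.coeff_zero] at this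
      rw [Submodule.mem_colon_singleton, Submodule.mem_bot, Algebra.smul_def, mul_comm]
      exact this

theorem MvPolynomial.hasGradeEqHeight (K : Type) [Field K] (n : ℕ) :
    HasGradeEqHeight (MvPolynomial (Fin n) K) := by
  induction n with
  | zero =>
    exact (HasGradeEqHeight.of_field K).of_ringEquiv
      (MvPolynomial.isEmptyRingEquiv K (Fin 0)).symm
  | succ n ih => exact ih.polynomial.of_ringEquiv (MvPolynomial.finSuccEquiv K n).toRingEquiv.symm

end Grade

/-- The minor of the first `s` rows and the columns `g` of an infinite matrix. -/
def leadingMinor {T : Type} [CommRing T] (X : ℕ → ℕ → T) (s : ℕ) (g : Fin s → ℕ) : T :=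
  (Matrix.of fun i j : Fin s => X i (g j)).det

/-- The ideal generated by `f` and the `s`-minors of the first `s` rows and `c` columns. -/
def leadingMinorIdeal {T : Type} [CommRing T] (f : Ideal T) (X : ℕ → ℕ → T) (s c : ℕ) : Ideal T :=
  f ⊔ Ideal.span (Set.range fun g : Fin s → Fin c => leadingMinor X s (fun j => g j))

section LeadingMinor
variable {T : Type} [CommRing T] (f : Ideal T) (X : ℕ → ℕ → T)

lemma leadingMinor_mem {s c : ℕ} (g : Fin s → ℕ) (hg : ∀ j, g j < c) :
    leadingMinor X s g ∈ leadingMinorIdeal f X s c :=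
  Ideal.mem_sup_right (Ideal.subset_span ⟨fun j => ⟨g j, hg j⟩, rfl⟩)

lemma leadingMinor_eq_zero {s : ℕ} (g : Fin s → ℕ) {i j : Fin s} (hij : i ≠ j) (h : g i = g j) :
    leadingMinor X s g = 0 :=
  Matrix.det_zero_of_column_eq hij fun k => by simp [h]

lemma leadingMinor_comp_perm {s : ℕ} (g : Fin s → ℕ) (σ : Equiv.Perm (Fin s)) :
    leadingMinor X s (g ∘ σ) = ((Equiv.Perm.sign σ : ℤ) : T) * leadingMinor X s g :=
  Matrix.det_permute' σ (Matrix.of fun i j : Fin s => X i (g j))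

lemma leadingMinorIdeal_mono_right {s c c' : ℕ} (h : c ≤ c') :
    leadingMinorIdeal f X s c ≤ leadingMinorIdeal f X s c' := by
  refine sup_le le_sup_left ?_
  rw [Ideal.span_le]
  rintro _ ⟨g, rfl⟩
  exact leadingMinor_mem f X _ fun j => (g j).2.trans_le h

lemma leadingMinorIdeal_succ_succ (s c : ℕ) :
    leadingMinorIdeal f X (s + 1) (c + 1) = leadingMinorIdeal f X (s + 1) c ⊔
      Ideal.span (Set.range fun g : Fin s → Fin c =>
        leadingMinor X (s + 1) (Fin.snoc (α := fun _ => ℕ) (fun j => (g j : ℕ)) c)) := by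
  apply le_antisymm
  · refine sup_le (le_sup_left.trans le_sup_left) ?_
    rw [Ideal.span_le]
    rintro _ ⟨g, rfl⟩
    by_cases h : ∀ j, (g j : ℕ) < c
    · exact Ideal.mem_sup_left (leadingMinor_mem f X _ h)
    push Not at h
    obtain ⟨k, hk⟩ := h
    have hk : (g k : ℕ) = c := le_antisymm (Nat.lt_succ_iff.mp (g k).2) hk
    set σ := Equiv.swap k (Fin.last s)
    set g' : Fin (s + 1) → ℕ := (fun j => (g j : ℕ)) ∘ σ with hg'
    have hg1 : g' (Fin.last s) = c := by simp [g', σ, hk]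
    have hg2 : (fun j => (g j : ℕ)) = g' ∘ σ := by
      ext j; simp [g', σ]
    show leadingMinor X (s + 1) (fun j => (g j : ℕ)) ∈ _
    rw [hg2, leadingMinor_comp_perm]
    apply Ideal.mul_mem_left
    by_cases h2 : ∀ j : Fin s, g' j.castSucc < c
    · refine Ideal.mem_sup_right (Ideal.subset_span ⟨fun j => ⟨_, h2 j⟩, ?_⟩)
      dsimp only
      congr 1
      ext j
      refine Fin.lastCases ?_ (fun j => ?_) j
      · simp [hg1]
      · simp
    · push Not at h2
      obtain ⟨j, hj⟩ := h2
      have hj2 : g' j.castSucc = c := le_antisymm (Nat.lt_succ_iff.mp (g _).2) hj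
      rw [leadingMinor_eq_zero X g' (Fin.castSucc_lt_last j).ne (hj2.trans hg1.symm)]
      exact zero_mem _
  · refine sup_le (leadingMinorIdeal_mono_right f X c.le_succ) ?_
    rw [Ideal.span_le]
    rintro _ ⟨g, rfl⟩
    refine leadingMinor_mem f X _ fun j => ?_
    refine Fin.lastCases ?_ (fun j => ?_) j
    · simp
    · simp [(g j).2.trans c.lt_succ_self]

/-- Laplace expansion along the last row. -/
lemma leadingMinor_succ (s : ℕ) (g : Fin (s + 1) → ℕ) :
    leadingMinor X (s + 1) g = ∑ j : Fin (s + 1), (-1) ^ (s + j : ℕ) * X s (g j) *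
      leadingMinor X s (g ∘ j.succAbove) := by
  unfold leadingMinor
  rw [Matrix.det_succ_row _ (Fin.last s)]
  refine Finset.sum_congr rfl fun j _ => ?_
  simp only [Fin.val_last, Matrix.of_apply, Fin.succAbove_last]
  rfl

lemma leadingMinorIdeal_eq_sup (s c : ℕ) :
    leadingMinorIdeal f X s c = leadingMinorIdeal f X (s + 1) c ⊔
      Ideal.span (Set.range fun g : Fin s → Fin c => leadingMinor X s (fun j => g j)) := by
  apply le_antisymm
  · exact sup_le_sup le_sup_left le_rfl
  · refine sup_le (sup_le le_sup_left ?_) le_sup_right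
    rw [Ideal.span_le]
    rintro _ ⟨g, rfl⟩
    dsimp only
    rw [leadingMinor_succ]
    exact Submodule.sum_mem _ fun j _ => Ideal.mul_mem_left _ _
      (leadingMinor_mem f X _ fun k => (g _).2)

/-- Expansion along the last column, with the coefficients not depending on that column. -/
lemma leadingMinor_snoc (s : ℕ) (g : Fin s → ℕ) : ∃ w : Fin (s + 1) → T,
    w (Fin.last s) = leadingMinor X s g ∧
    ∀ l, leadingMinor X (s + 1) (Fin.snoc (α := fun _ => ℕ) g l) = ∑ k, w k * X k l := by
  refine ⟨fun k => (-1) ^ (k + s : ℕ) *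
    (Matrix.of fun i j : Fin s => X (k.succAbove i) (g j)).det, ?_, fun l => ?_⟩
  · simp only [Fin.val_last, ← two_mul, pow_mul, Fin.succAbove_last]
    simp [leadingMinor]
  · unfold leadingMinor
    rw [Matrix.det_succ_column _ (Fin.last s)]
    refine Finset.sum_congr rfl fun k _ => ?_
    simp only [Fin.val_last, Matrix.of_apply, Fin.snoc_last, Fin.succAbove_last]
    rw [mul_assoc, mul_comm (X _ _), ← mul_assoc]
    congr 3
    ext i j
    simp

lemma leadingMinor_mul_sub_mem (s c : ℕ) (g g' : Fin s → Fin c) :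
    leadingMinor X (s + 1) (Fin.snoc (α := fun _ => ℕ) (fun j => (g j : ℕ)) c) *
        leadingMinor X s (fun j => g' j) -
      leadingMinor X (s + 1) (Fin.snoc (α := fun _ => ℕ) (fun j => (g' j : ℕ)) c) *
        leadingMinor X s (fun j => g j) ∈ leadingMinorIdeal f X (s + 1) c := by
  obtain ⟨w, hw1, hw2⟩ := leadingMinor_snoc X s (fun j => g j)
  set gc : Fin (s + 1) → ℕ := Fin.snoc (α := fun _ => ℕ) (fun j => (g' j : ℕ)) c
  set N : Matrix (Fin (s + 1)) (Fin (s + 1)) T := Matrix.of fun i j => X i (gc j) with hN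
  have h1 := Matrix.det_updateRow_sum N (Fin.last s) w
  have h2 : (N.updateRow (Fin.last s) (∑ k, w k • N k)).det - 
      leadingMinor X (s + 1) (Fin.snoc (α := fun _ => ℕ) (fun j => (g j : ℕ)) c) *
        leadingMinor X s (fun j => g' j) ∈ leadingMinorIdeal f X (s + 1) c := by
    rw [Matrix.det_succ_row _ (Fin.last s), Fin.sum_univ_castSucc, add_sub_assoc]
    have hrow (j : Fin (s + 1)) : (∑ k, w k • N k) j =
        leadingMinor X (s + 1) (Fin.snoc (α := fun _ => ℕ) (fun j => (g j : ℕ)) (gc j)) := by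
      rw [hw2, Finset.sum_apply]; rfl
    apply Ideal.add_mem
    · refine Submodule.sum_mem _ fun j _ => Ideal.mul_mem_right _ _ (Ideal.mul_mem_left _ _ ?_)
      rw [Matrix.updateRow_self, hrow]
      refine leadingMinor_mem f X _ fun k => ?_
      refine Fin.lastCases ?_ (fun j => ?_) k
      · simp [gc]
      · simp
    · rw [Matrix.updateRow_self, hrow]
      have : ((N.updateRow (Fin.last s) (∑ k, w k • N k)).submatrix (Fin.last s).succAbove
          (Fin.last s).succAbove).det = leadingMinor X s (fun j => g' j) := by
        unfold leadingMinor
        congr 1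
        ext i j
        simp [hN, gc]
      rw [this]
      simp [gc, ← two_mul, pow_mul]
  rw [h1, smul_eq_mul, hw1] at h2
  rw [← neg_mem_iff]
  convert h2 using 1
  have : N.det = leadingMinor X (s + 1) gc := rfl
  rw [this]; ring

lemma leadingMinorIdeal_succ_self (c : ℕ) : leadingMinorIdeal f X (c + 1) c = f := by
  refine le_antisymm (sup_le le_rfl ?_) le_sup_left
  rw [Ideal.span_le]
  rintro _ ⟨g, rfl⟩
  obtain ⟨i, j, hij, h⟩ := Fintype.exists_ne_map_eq_of_card_lt g (by simp)
  dsimp only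
  rw [leadingMinor_eq_zero X _ hij (by rw [h])]
  exact zero_mem _

theorem CodimDepth.quotient_leadingMinorIdeal [IsNoetherianRing T] [Algebra ℂ T] {p n : ℕ}
    (hf : CodimDepth T p (T ⧸ f)) (hp : leadingMinorIdeal f X p p = ⊤)
    (hht : ∀ s c, p ≤ s → s ≤ c → c ≤ n → ∀ Q : Ideal T, Q.IsPrime →
      leadingMinorIdeal f X s c ≤ Q → ((p + c + 1 - s : ℕ) : ℕ∞) ≤ Q.height) :
    ∀ c, c ≤ n → ∀ s, p ≤ s → s ≤ c + 1 →
      CodimDepth T (p + c + 1 - s) (T ⧸ leadingMinorIdeal f X s c) := by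
  have base1 (c : ℕ) :
      CodimDepth T (p + c + 1 - (c + 1)) (T ⧸ leadingMinorIdeal f X (c + 1) c) := by
    rw [leadingMinorIdeal_succ_self]
    convert hf using 1
    omega
  have base2 (c : ℕ) (hc : p ≤ c) :
      CodimDepth T (p + c + 1 - p) (T ⧸ leadingMinorIdeal f X p c) := by
    have : leadingMinorIdeal f X p c = ⊤ :=
      top_le_iff.mp (hp.symm.trans_le (leadingMinorIdeal_mono_right f X hc))
    rw [this]
    have : Subsingleton (T ⧸ (⊤ : Ideal T)) := Ideal.Quotient.subsingleton_iff.mpr rfl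
    exact CodimDepth.of_subsingleton _
  intro c
  induction c with
  | zero =>
    intro _ s hs hs2
    by_cases h : s = 0 + 1
    · subst h; exact base1 0
    · have : s = p := by omega
      subst this
      exact base2 0 (by omega)
  | succ c ih =>
    intro hc s hs hs2
    by_cases h : s = c + 1 + 1
    · subst h; exact base1 (c + 1)
    by_cases h' : s = p
    · subst h'; exact base2 (c + 1) (by omega)
    obtain ⟨s, rfl⟩ : ∃ t, s = t + 1 := ⟨s - 1, by omega⟩
    rw [leadingMinorIdeal_succ_succ, show p + (c + 1) + 1 - (s + 1) = p + c - s + 1 by omega]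
    refine CodimDepth.of_proportional _ (fun g : Fin s → Fin c => leadingMinor X s (fun j => g j))
      _ (leadingMinor_mul_sub_mem f X s c) ?_ ?_ ?_ ?_
    · convert ih (by omega) (s + 1) (by omega) (by omega) using 1
      omega
    · rw [← leadingMinorIdeal_eq_sup]
      convert ih (by omega) s (by omega) (by omega) using 1
      omega
    · intro Q hQ hI hu
      have := hht (s + 1) (c + 1) (by omega) (by omega) hc Q hQ (by
        rw [leadingMinorIdeal_succ_succ]
        exact sup_le hI (Ideal.span_le.mpr (by rintro _ ⟨g, rfl⟩; exact hu g)))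
      convert this using 2
      omega
    · intro Q hQ hI hv
      have := hht s c (by omega) (by omega) (by omega) Q hQ (by
        rw [leadingMinorIdeal_eq_sup]
        exact sup_le hI (Ideal.span_le.mpr (by rintro _ ⟨g, rfl⟩; exact hv g)))
      convert this using 2
      omega

end LeadingMinor

end CodimDepthOfExt

section Jacobian
open MvPolynomial

/-- The differentials of the family `G` are linearly independent modulo the prime `P`. -/
def IndependentDifferentials {n : ℕ} {τ : Type} [Fintype τ] (P : Ideal (MvPolynomial (Fin n) ℂ))
    (G : τ → MvPolynomial (Fin n) ℂ) : Prop :=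
  ∀ r : τ → MvPolynomial (Fin n) ℂ, (∀ l, ∑ t, r t * pderiv l (G t) ∈ P) → ∀ t, r t ∈ P

lemma pderiv_mem_of_mem_sq {n : ℕ} {P : Ideal (MvPolynomial (Fin n) ℂ)}
    {x : MvPolynomial (Fin n) ℂ} (hx : x ∈ P ^ 2) (l : Fin n) : pderiv l x ∈ P := by
  rw [pow_two] at hx
  refine Submodule.mul_induction_on hx (fun a ha b hb => ?_) (fun a b ha hb => ?_)
  · rw [Derivation.leibniz, smul_eq_mul, smul_eq_mul]
    exact P.add_mem (P.mul_mem_right _ ha) (P.mul_mem_right _ hb)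
  · rw [map_add]; exact P.add_mem ha hb

lemma mem_span_of_cotangent_span_eq_top {R : Type} [CommRing R] [IsNoetherianRing R] {P : Ideal R}
    [P.IsPrime] {ι : Type} (G : ι → R) (hG : ∀ t, algebraMap R (Localization.AtPrime P) (G t) ∈
      IsLocalRing.maximalIdeal (Localization.AtPrime P))
    (h : Submodule.span (IsLocalRing.ResidueField (Localization.AtPrime P))
      (Set.range fun t => (IsLocalRing.maximalIdeal (Localization.AtPrime P)).toCotangent
        ⟨algebraMap R _ (G t), hG t⟩) = ⊤) {x : R} (hx : x ∈ P) :
    ∃ s ∉ P, s * x ∈ Ideal.span (Set.range G) := by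
  set A := Localization.AtPrime P
  have h2 : Submodule.span A (Set.range fun t =>
      (⟨algebraMap R A (G t), hG t⟩ : IsLocalRing.maximalIdeal A)) = ⊤ := by
    rw [← IsLocalRing.CotangentSpace.span_image_eq_top_iff, ← Set.range_comp]
    exact h
  have h3 : IsLocalRing.maximalIdeal A = (Ideal.span (Set.range G)).map (algebraMap R A) := by
    have := congrArg (Submodule.map (Submodule.subtype (IsLocalRing.maximalIdeal A))) h2
    rw [Submodule.map_top, Submodule.range_subtype, Submodule.map_span, ← Set.range_comp] at this
    rw [Ideal.map_span, ← Set.range_comp, ← this]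
    rfl
  have h4 : algebraMap R A x ∈ IsLocalRing.maximalIdeal A :=
    (IsLocalization.AtPrime.to_map_mem_maximal_iff A P x).2 hx
  rw [h3, IsLocalization.algebraMap_mem_map_algebraMap_iff P.primeCompl] at h4
  obtain ⟨s, hs, h5⟩ := h4
  exact ⟨s, hs, h5⟩

lemma finrank_cotangentSpace_localization {n : ℕ} (P : Ideal (MvPolynomial (Fin n) ℂ))
    [P.IsPrime] : (Module.finrank (IsLocalRing.ResidueField (Localization.AtPrime P))
      (IsLocalRing.CotangentSpace (Localization.AtPrime P)) : ℕ∞) = P.height := by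
  have h := (IsRegularLocalRing.iff_finrank_cotangentSpace (Localization.AtPrime P)).1
    (IsRegularRing.isRegularLocalRing_localization P)
  rw [IsLocalization.AtPrime.ringKrullDim_eq_height P] at h
  exact_mod_cast h

lemma algebraMap_mem_maximalIdeal {R τ : Type} [CommRing R] {P : Ideal R} [P.IsPrime] {G : τ → R}
    (hG : ∀ t, G t ∈ P) (t : τ) : algebraMap _ (Localization.AtPrime P) (G t) ∈
    IsLocalRing.maximalIdeal (Localization.AtPrime P) :=
  (IsLocalization.AtPrime.to_map_mem_maximal_iff _ P _).2 (hG t)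

namespace IndependentDifferentials
variable {n : ℕ} {τ : Type} [Fintype τ] {P : Ideal (MvPolynomial (Fin n) ℂ)} [P.IsPrime]
  {G : τ → MvPolynomial (Fin n) ℂ}

lemma linearIndependent (h : IndependentDifferentials P G)
    (hG : ∀ t, algebraMap _ (Localization.AtPrime P) (G t) ∈
      IsLocalRing.maximalIdeal (Localization.AtPrime P)) :
    LinearIndependent (IsLocalRing.ResidueField (Localization.AtPrime P))
      (fun t => ((IsLocalRing.maximalIdeal (Localization.AtPrime P)).toCotangent
        ⟨algebraMap _ _ (G t), hG t⟩ : IsLocalRing.CotangentSpace (Localization.AtPrime P))) := by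
  set A := Localization.AtPrime P with hA
  rw [Fintype.linearIndependent_iff]
  intro c hc
  choose α hα using fun t => IsLocalRing.residue_surjective (R := A) (c t)
  obtain ⟨b, hb⟩ := IsLocalization.exist_integer_multiples_of_finite P.primeCompl α
  choose r hr using hb
  have h1 : ∑ t, α t •
      (IsLocalRing.maximalIdeal A).toCotangent ⟨algebraMap _ A (G t), hG t⟩ = 0 := by
    rw [← hc]
    refine Finset.sum_congr rfl fun t _ => ?_
    rw [← hα t]
    rfl
  have h2 : ((b : MvPolynomial (Fin n) ℂ) • ∑ t, α t * algebraMap _ A (G t)) ∈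
      (IsLocalRing.maximalIdeal A) ^ 2 := by
    rw [Algebra.smul_def]
    refine Ideal.mul_mem_left _ _ ?_
    have h3 : (IsLocalRing.maximalIdeal A).toCotangent
        (∑ t, α t • ⟨algebraMap _ A (G t), hG t⟩) = 0 := by
      rw [map_sum, ← h1]
      simp only [map_smul]
    rw [Ideal.toCotangent_eq_zero] at h3
    convert h3
    simp
  have h3 : algebraMap _ A (∑ t, r t * G t) ∈ (P ^ 2).map (algebraMap _ A) := by
    rw [Ideal.map_pow, Localization.AtPrime.map_eq_maximalIdeal]
    convert h2
    rw [Finset.smul_sum, map_sum]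
    refine Finset.sum_congr rfl fun t _ => ?_
    rw [map_mul, hr t, smul_mul_assoc]
  rw [IsLocalization.algebraMap_mem_map_algebraMap_iff P.primeCompl] at h3
  obtain ⟨s, hs, h4⟩ := h3
  have hGP : ∀ t, G t ∈ P := fun t =>
    (IsLocalization.AtPrime.to_map_mem_maximal_iff A P (G t)).1 (hG t)
  have h5 : ∀ t, r t ∈ P := by
    refine h r fun l => ?_
    have h6 := pderiv_mem_of_mem_sq h4 l
    rw [Derivation.leibniz, smul_eq_mul, smul_eq_mul, map_sum] at h6
    have h7 : (∑ t, r t * G t) * pderiv l s ∈ P :=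
      P.mul_mem_right _ (P.sum_mem fun t _ => P.mul_mem_left _ (hGP t))
    have h8 := (P.add_mem_iff_left h7).1 h6
    have h9 := (Ideal.IsPrime.mem_or_mem ‹P.IsPrime› h8).resolve_left hs
    have h10 : ∑ t, pderiv l (r t * G t) =
        ∑ t, r t * pderiv l (G t) + ∑ t, G t * pderiv l (r t) := by
      rw [← Finset.sum_add_distrib]
      exact Finset.sum_congr rfl fun t _ => by rw [Derivation.leibniz, smul_eq_mul, smul_eq_mul]
    rw [h10] at h9
    exact (P.add_mem_iff_left (P.sum_mem fun t _ => P.mul_mem_right _ (hGP t))).1 h9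
  intro t
  rw [← hα t, IsLocalRing.residue_eq_zero_iff]
  have h6 : algebraMap _ A (r t) ∈ IsLocalRing.maximalIdeal A :=
    (IsLocalization.AtPrime.to_map_mem_maximal_iff A P (r t)).2 (h5 t)
  rw [hr t, Algebra.smul_def] at h6
  refine (Ideal.IsPrime.mem_or_mem inferInstance h6).resolve_left fun h7 => ?_
  exact b.2 ((IsLocalization.AtPrime.to_map_mem_maximal_iff A P _).1 h7)

theorem card_le_height (h : IndependentDifferentials P G) (hG : ∀ t, G t ∈ P) :
    (Fintype.card τ : ℕ∞) ≤ P.height := by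
  rw [← finrank_cotangentSpace_localization P]
  exact_mod_cast (h.linearIndependent (algebraMap_mem_maximalIdeal hG)).fintype_card_le_finrank

theorem mem_span_of_height_le (h : IndependentDifferentials P G) (hG : ∀ t, G t ∈ P)
    (hP : P.height ≤ Fintype.card τ) {x : MvPolynomial (Fin n) ℂ} (hx : x ∈ P) :
    ∃ s ∉ P, s * x ∈ Ideal.span (Set.range G) := by
  refine mem_span_of_cotangent_span_eq_top G (algebraMap_mem_maximalIdeal hG) ?_ hx
  refine (h.linearIndependent (algebraMap_mem_maximalIdeal hG)).span_eq_top_of_card_eq_finrank' ?_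
  have := le_antisymm hP (h.card_le_height hG)
  rw [← finrank_cotangentSpace_localization P] at this
  exact_mod_cast this.symm

theorem exists_mem_span_of_height_le_succ (h : IndependentDifferentials P G) (hG : ∀ t, G t ∈ P)
    (hP : P.height ≤ Fintype.card τ + 1) : ∃ y ∈ P, ∀ x ∈ P,
    ∃ s ∉ P, s * x ∈ Ideal.span (Set.range G) ⊔ Ideal.span {y} := by
  set A := Localization.AtPrime P with hA
  by_cases hle : P.height ≤ Fintype.card τ
  · refine ⟨0, P.zero_mem, fun x hx => ?_⟩
    obtain ⟨s, hs, h1⟩ := h.mem_span_of_height_le hG hle hx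
    exact ⟨s, hs, Ideal.mem_sup_left h1⟩
  have hli := h.linearIndependent (algebraMap_mem_maximalIdeal hG)
  have hfr : Fintype.card τ + 1 = Module.finrank (IsLocalRing.ResidueField A)
      (IsLocalRing.CotangentSpace A) := by
    rw [← finrank_cotangentSpace_localization P] at hle hP
    have h1 : ¬ (Module.finrank (IsLocalRing.ResidueField A) (IsLocalRing.CotangentSpace A) ≤
      Fintype.card τ) := fun h2 => hle (by exact_mod_cast h2)
    have h2 : Module.finrank (IsLocalRing.ResidueField A) (IsLocalRing.CotangentSpace A) ≤
      Fintype.card τ + 1 := by exact_mod_cast hP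
    omega
  have hne : Submodule.span (IsLocalRing.ResidueField A) (Set.range fun t =>
      ((IsLocalRing.maximalIdeal A).toCotangent
        ⟨algebraMap _ _ (G t), algebraMap_mem_maximalIdeal hG t⟩ :
          IsLocalRing.CotangentSpace A)) ≠ ⊤ := by
    intro h1
    have := finrank_range_le_card (R := IsLocalRing.ResidueField A) (fun t =>
      ((IsLocalRing.maximalIdeal A).toCotangent
        ⟨algebraMap _ _ (G t), algebraMap_mem_maximalIdeal hG t⟩ :
          IsLocalRing.CotangentSpace A))
    rw [Set.finrank, h1, finrank_top] at this
    exact absurd (hfr.le.trans this) (by omega)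
  obtain ⟨v, -, hv⟩ := SetLike.exists_of_lt (lt_top_iff_ne_top.2 hne)
  obtain ⟨z, rfl⟩ := Ideal.toCotangent_surjective _ v
  obtain ⟨b, y, hy⟩ := IsLocalization.exists_integer_multiple P.primeCompl (z : A)
  rw [Algebra.smul_def] at hy
  have hbu : IsUnit (algebraMap _ A (b : MvPolynomial (Fin n) ℂ)) := IsLocalization.map_units A b
  have hyA : algebraMap _ A y ∈ IsLocalRing.maximalIdeal A := by
    rw [hy]; exact Ideal.mul_mem_left _ _ z.2
  have hyP : y ∈ P := (IsLocalization.AtPrime.to_map_mem_maximal_iff A P y).1 hyA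
  have hv2 : ((IsLocalRing.maximalIdeal A).toCotangent ⟨algebraMap _ A y, hyA⟩ :
      IsLocalRing.CotangentSpace A) ∉
        Submodule.span (IsLocalRing.ResidueField A) (Set.range fun t =>
      ((IsLocalRing.maximalIdeal A).toCotangent
        ⟨algebraMap _ _ (G t), algebraMap_mem_maximalIdeal hG t⟩ :
          IsLocalRing.CotangentSpace A)) := by
    intro h1
    apply hv
    have h2 : (⟨algebraMap _ A y, hyA⟩ : IsLocalRing.maximalIdeal A) =
      (algebraMap _ A (b : MvPolynomial (Fin n) ℂ)) • z := Subtype.ext hy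
    rw [h2, map_smul] at h1
    obtain ⟨u, hu⟩ := hbu
    have h3 := Submodule.smul_mem _ (IsLocalRing.residue A (↑u⁻¹ : A)) h1
    have h4 : IsLocalRing.residue A (↑u⁻¹ : A) • ((algebraMap _ A (b : MvPolynomial (Fin n) ℂ)) •
        (IsLocalRing.maximalIdeal A).toCotangent z : IsLocalRing.CotangentSpace A) =
        (IsLocalRing.maximalIdeal A).toCotangent z := by
      change (↑u⁻¹ : A) • ((algebraMap _ A (b : MvPolynomial (Fin n) ℂ)) •
        (IsLocalRing.maximalIdeal A).toCotangent z) = _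
      rw [← hu, smul_smul, Units.inv_mul, one_smul]
    rwa [h4] at h3
  refine ⟨y, hyP, fun x hx => ?_⟩
  have h5 := mem_span_of_cotangent_span_eq_top (P := P) (fun o : Option τ => o.casesOn' y G)
    (fun o => by cases o with
      | none => exact hyA
      | some t => exact algebraMap_mem_maximalIdeal hG t) ?_ hx
  · obtain ⟨s, hs, h6⟩ := h5
    refine ⟨s, hs, ?_⟩
    have h7 : Set.range (fun o : Option τ => o.casesOn' y G) ⊆ Set.range G ∪ {y} := by
      rintro _ ⟨o, rfl⟩
      cases o with
      | none => exact Or.inr rfl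
      | some t => exact Or.inl ⟨t, rfl⟩
    rw [← Ideal.span_union]
    exact Ideal.span_mono h7 h6
  · have h6 := (hli.option hv2).span_eq_top_of_card_eq_finrank' (by
      rw [Fintype.card_option, hfr])
    rw [← h6]
    congr 2
    funext o
    cases o <;> rfl

end IndependentDifferentials
end Jacobian

section GenericSmoothness
open MvPolynomial
open scoped TensorProduct

lemma exists_derivation_algebraMap_eq_pderiv {κ : Type} {L : Type} [Field L] [Algebra ℂ L]
    [Algebra (MvPolynomial κ ℂ) L] [IsScalarTower ℂ (MvPolynomial κ ℂ) L]
    [Algebra.EssFiniteType ℂ L]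
    (hinj : Function.Injective (algebraMap (MvPolynomial κ ℂ) L)) (k : κ) :
    ∃ D : Derivation ℂ L L, ∀ f, D (algebraMap (MvPolynomial κ ℂ) L f) =
      algebraMap (MvPolynomial κ ℂ) L (pderiv k f) := by
  set B := MvPolynomial κ ℂ
  have : FaithfulSMul B L := (faithfulSMul_iff_algebraMap_injective B L).2 hinj
  let K := FractionRing B
  let : Algebra K L := FractionRing.liftAlgebra B L
  have : IsScalarTower B K L := FractionRing.isScalarTower_liftAlgebra B L
  have : IsScalarTower ℂ K L := IsScalarTower.of_algebraMap_eq fun x => by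
    rw [IsScalarTower.algebraMap_apply ℂ B L, IsScalarTower.algebraMap_apply B K L,
      IsScalarTower.algebraMap_apply ℂ B K]
  have : Algebra.EssFiniteType K L := Algebra.EssFiniteType.of_comp ℂ K L
  have : CharZero K := inferInstance
  have : Algebra.FormallySmooth K L := Algebra.FormallySmooth.of_perfectField
  have : Algebra.FormallySmooth B K :=
    Algebra.FormallySmooth.of_isLocalization (nonZeroDivisors B)
  have : Algebra.FormallySmooth B L := Algebra.FormallySmooth.comp B K L
  have hex := Algebra.H1Cotangent.exact_δ_mapBaseChange ℂ B L
  have hker : LinearMap.ker (KaehlerDifferential.mapBaseChange ℂ B L) = ⊥ := by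
    rw [eq_bot_iff]
    intro x hx
    obtain ⟨y, rfl⟩ := (hex x).1 hx
    rw [Subsingleton.elim y 0, map_zero]
    exact Submodule.zero_mem _
  obtain ⟨g, hg⟩ := LinearMap.exists_leftInverse_of_injective _ hker
  let d0 : Derivation ℂ B L := (Algebra.linearMap B L).compDer (pderiv k : Derivation ℂ B B)
  let φ : TensorProduct B L (Ω[B⁄ℂ]) →ₗ[L] L :=
    LinearMap.liftBaseChange L d0.liftKaehlerDifferential
  refine ⟨(φ ∘ₗ g).compDer (KaehlerDifferential.D ℂ L), fun f => ?_⟩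
  have h1 : KaehlerDifferential.D ℂ L (algebraMap B L f) =
      KaehlerDifferential.mapBaseChange ℂ B L (1 ⊗ₜ KaehlerDifferential.D ℂ B f) := by
    simp
  have h2 : g (KaehlerDifferential.mapBaseChange ℂ B L (1 ⊗ₜ KaehlerDifferential.D ℂ B f)) =
      1 ⊗ₜ KaehlerDifferential.D ℂ B f := LinearMap.congr_fun hg _
  change φ (g (KaehlerDifferential.D ℂ L (algebraMap B L f))) = _
  rw [h1, h2]
  simp only [φ, LinearMap.liftBaseChange_tmul, Derivation.liftKaehlerDifferential_comp_D, one_smul]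
  rfl

lemma Matrix.exists_det_submatrix_ne_zero {τ ν K : Type} [Field K] [Fintype τ] [DecidableEq τ]
    [Fintype ν] (M : Matrix τ ν K) (h : LinearIndependent K M.row) :
    ∃ e : τ → ν, (M.submatrix id e).det ≠ 0 := by
  have hr : M.rank = Fintype.card τ := h.rank_matrix
  have hspan : Submodule.span K (Set.range M.col) = ⊤ := by
    apply Submodule.eq_top_of_finrank_eq
    rw [← Matrix.rank_eq_finrank_span_cols, hr, Module.finrank_fintype_fun_eq_card]
  obtain ⟨κ, a, -, ha, hli⟩ := exists_linearIndependent' K M.col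
  rw [hspan] at ha
  have : Finite κ := hli.finite
  have := Fintype.ofFinite κ
  have hc : Fintype.card τ = Fintype.card κ := by
    have := finrank_span_eq_card hli
    rw [ha, finrank_top, Module.finrank_fintype_fun_eq_card] at this
    exact this
  let e := Fintype.equivOfCardEq hc
  refine ⟨a ∘ e, ?_⟩
  have h2 : LinearIndependent K (M.submatrix id (a ∘ e)).col := hli.comp e e.injective
  rw [Matrix.linearIndependent_cols_iff_isUnit, Matrix.isUnit_iff_isUnit_det] at h2
  exact h2.ne_zero

end GenericSmoothness

section GenericSmoothness
open MvPolynomial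

/-- Substitution of the constants `a` for the parameters. -/
noncomputable def specialize {n : ℕ} {κ : Type} (a : κ → ℂ) :
    MvPolynomial (Fin n ⊕ κ) ℂ →ₐ[ℂ] MvPolynomial (Fin n) ℂ :=
  aeval (Sum.elim X fun k => C (a k))

lemma pderiv_specialize {n : ℕ} {κ : Type} (a : κ → ℂ) (l : Fin n)
    (g : MvPolynomial (Fin n ⊕ κ) ℂ) :
    pderiv l (specialize a g) = specialize a (pderiv (Sum.inl l) g) := by
  classical
  induction g using MvPolynomial.induction_on with
  | C c => simp [specialize]
  | add p q hp hq => simp [hp, hq]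
  | mul_X p v h =>
    rw [map_mul, Derivation.leibniz, h, Derivation.leibniz, map_add]
    simp only [smul_eq_mul, map_mul]
    congr 2
    cases v with
    | inl j =>
      simp only [specialize, aeval_X, Sum.elim_inl, pderiv_X, Pi.single_apply, Sum.inl.injEq]
      split_ifs <;> simp
    | inr k => simp [specialize, pderiv_X]

lemma specialize_rename_inr {n : ℕ} {κ : Type} (a : κ → ℂ) (f : MvPolynomial κ ℂ) :
    specialize (n := n) a (rename Sum.inr f) = C (eval a f) := by
  rw [specialize, aeval_rename]
  induction f using MvPolynomial.induction_on with
  | C c => simp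
  | add p q hp hq => rw [map_add, hp, hq, map_add, map_add]
  | mul_X p v h =>
    rw [map_mul, h, map_mul, map_mul, aeval_X, eval_X]
    rfl

lemma Derivation.apply_mvPolynomial {σ L : Type} [Fintype σ] [Field L] [Algebra ℂ L]
    (ψ : MvPolynomial σ ℂ →ₐ[ℂ] L) (D : Derivation ℂ L L) (g : MvPolynomial σ ℂ) :
    D (ψ g) = ∑ v, ψ (pderiv v g) * D (ψ (X v)) := by
  classical
  induction g using MvPolynomial.induction_on with
  | C c =>
    rw [← algebraMap_eq, AlgHom.commutes, Derivation.map_algebraMap]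
    simp
  | add p q hp hq => simp [hp, hq, add_mul, Finset.sum_add_distrib]
  | mul_X p v h =>
    rw [map_mul, Derivation.leibniz, h]
    simp only [Derivation.leibniz, pderiv_X, smul_eq_mul, map_add, map_mul, add_mul,
      Finset.sum_add_distrib, Finset.mul_sum]
    congr 1
    · rw [Finset.sum_eq_single v]
      · simp
      · intro b _ hb
        simp [hb.symm]
      · simp
    · exact Finset.sum_congr rfl fun i _ => by ring

lemma sum_mul_pderiv_inr_eq_zero {σ κ τ L : Type} [Fintype σ] [Fintype κ] [Fintype τ] [Field L]
    [Algebra ℂ L] [Algebra.EssFiniteType ℂ L] (ψ : MvPolynomial (σ ⊕ κ) ℂ →ₐ[ℂ] L)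
    (hψ : Function.Injective (ψ.comp (rename Sum.inr))) (G : τ → MvPolynomial (σ ⊕ κ) ℂ)
    (hG : ∀ t, ψ (G t) = 0) (c : τ → L) (hc : ∀ l, ∑ t, c t * ψ (pderiv (Sum.inl l) (G t)) = 0)
    (k : κ) : ∑ t, c t * ψ (pderiv (Sum.inr k) (G t)) = 0 := by
  classical
  let _ : Algebra (MvPolynomial κ ℂ) L := (ψ.comp (rename Sum.inr)).toRingHom.toAlgebra
  have halg : ∀ f : MvPolynomial κ ℂ, algebraMap (MvPolynomial κ ℂ) L f =
    ψ (rename Sum.inr f) := fun _ => rfl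
  have : IsScalarTower ℂ (MvPolynomial κ ℂ) L := IsScalarTower.of_algebraMap_eq fun x => by
    rw [halg, algebraMap_eq, rename_C, ← algebraMap_eq, AlgHom.commutes]
  obtain ⟨D, hD⟩ := exists_derivation_algebraMap_eq_pderiv (L := L) hψ k
  have h1 : ∀ t, ψ (pderiv (Sum.inr k) (G t)) =
      - ∑ l, ψ (pderiv (Sum.inl l) (G t)) * D (ψ (X (Sum.inl l))) := by
    intro t
    have h2 := D.apply_mvPolynomial ψ (G t)
    rw [hG t, map_zero, Fintype.sum_sum_type] at h2
    have h3 : ∀ k', D (ψ (X (Sum.inr k'))) = if k' = k then 1 else 0 := by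
      intro k'
      have h4 := hD (X k')
      rw [halg, rename_X, halg, pderiv_X] at h4
      rw [h4, Pi.single_apply]
      split_ifs <;> simp
    simp only [h3, mul_ite, mul_one, mul_zero, Finset.sum_ite_eq', Finset.mem_univ,
      if_true] at h2
    exact eq_neg_of_add_eq_zero_right h2.symm
  simp only [h1, mul_neg, Finset.sum_neg_distrib, Finset.mul_sum]
  rw [Finset.sum_comm, neg_eq_zero]
  refine Finset.sum_eq_zero fun l _ => ?_
  simp only [← mul_assoc]
  rw [← Finset.sum_mul, hc l, zero_mul]

lemma IndependentDifferentials.of_det_notMem {n : ℕ} {τ : Type} [Fintype τ] [DecidableEq τ]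
    {P : Ideal (MvPolynomial (Fin n) ℂ)} [P.IsPrime] {G : τ → MvPolynomial (Fin n) ℂ}
    (e : τ → Fin n) (h : (Matrix.of fun t u => pderiv (e u) (G t)).det ∉ P) :
    IndependentDifferentials P G := by
  intro r hr t
  set M := (Matrix.of fun t u => pderiv (e u) (G t)).map (Ideal.Quotient.mk P) with hM
  have hdet : M.det ≠ 0 := by
    rw [hM, ← RingHom.mapMatrix_apply, ← RingHom.map_det, Ne, Ideal.Quotient.eq_zero_iff_mem]
    exact h
  have h1 := Matrix.eq_zero_of_vecMul_eq_zero (v := fun t => Ideal.Quotient.mk P (r t)) hdet (by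
    funext u
    have := hr (e u)
    rw [← Ideal.Quotient.eq_zero_iff_mem, map_sum] at this
    simpa [Matrix.vecMul, dotProduct, hM] using this)
  exact Ideal.Quotient.eq_zero_iff_mem.1 (congrFun h1 t)

theorem exists_generic_independentDifferentials {n : ℕ} {κ τ : Type} [Fintype κ] [Fintype τ]
    (G : τ → MvPolynomial (Fin n ⊕ κ) ℂ) (Δ : MvPolynomial (Fin n ⊕ κ) ℂ)
    (hfull : ∀ Q : Ideal (MvPolynomial (Fin n ⊕ κ) ℂ), Q.IsPrime → (∀ t, G t ∈ Q) → Δ ∉ Q →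
      ∀ r : τ → MvPolynomial (Fin n ⊕ κ) ℂ, (∀ v, ∑ t, r t * pderiv v (G t) ∈ Q) → ∀ t, r t ∈ Q) :
    ∃ f : MvPolynomial κ ℂ, f ≠ 0 ∧ ∀ a : κ → ℂ, eval a f ≠ 0 →
      ∀ P : Ideal (MvPolynomial (Fin n) ℂ), P.IsPrime → (∀ t, specialize a (G t) ∈ P) →
        specialize a Δ ∉ P → IndependentDifferentials P fun t => specialize a (G t) := by
  classical
  let R := MvPolynomial (Fin n ⊕ κ) ℂ
  let J : Ideal R := Ideal.span (Set.range G) ⊔ Ideal.span (Set.range fun e : τ → Fin n =>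
    (Matrix.of fun t u => pderiv (Sum.inl (e u)) (G t)).det)
  let S : Submonoid R := Submonoid.powers Δ ⊔ (nonZeroDivisors (MvPolynomial κ ℂ)).map
    (rename Sum.inr : MvPolynomial κ ℂ →ₐ[ℂ] R)
  have key : ¬ Disjoint (J : Set R) (S : Set R) := by
    intro hdisj
    obtain ⟨Q, hQ, hJQ, hQS⟩ := Ideal.exists_le_prime_disjoint J S hdisj
    have hGQ : ∀ t, G t ∈ Q := fun t =>
      hJQ (Ideal.mem_sup_left (Ideal.subset_span ⟨t, rfl⟩))
    have hΔQ : Δ ∉ Q := fun h => Set.disjoint_left.1 hQS h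
      (Submonoid.mem_sup_left (Submonoid.mem_powers Δ))
    let L := FractionRing (R ⧸ Q)
    have hker : ∀ x : R, algebraMap R L x = 0 ↔ x ∈ Q := fun x => by
      rw [IsScalarTower.algebraMap_apply R (R ⧸ Q) L, FaithfulSMul.algebraMap_eq_zero_iff]
      exact Ideal.Quotient.eq_zero_iff_mem
    have : Algebra.EssFiniteType (R ⧸ Q) L :=
      Algebra.EssFiniteType.of_isLocalization _ (nonZeroDivisors (R ⧸ Q))
    have : Algebra.EssFiniteType ℂ L := Algebra.EssFiniteType.comp ℂ (R ⧸ Q) L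
    have hinj : Function.Injective ((IsScalarTower.toAlgHom ℂ R L).comp
        (rename Sum.inr : MvPolynomial κ ℂ →ₐ[ℂ] R)) := by
      rw [injective_iff_map_eq_zero]
      intro f hf
      rw [AlgHom.comp_apply, IsScalarTower.coe_toAlgHom', hker] at hf
      by_contra hf0
      exact Set.disjoint_left.1 hQS hf (Submonoid.mem_sup_right
        (Submonoid.mem_map_of_mem _ (mem_nonZeroDivisors_of_ne_zero hf0)))
    let M : Matrix τ (Fin n) L := Matrix.of fun t l => algebraMap R L (pderiv (Sum.inl l) (G t))
    have hM : ¬ LinearIndependent L M.row := by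
      intro h
      obtain ⟨e, he⟩ := Matrix.exists_det_submatrix_ne_zero M h
      apply he
      have h1 : (Matrix.of fun t u => pderiv (Sum.inl (e u)) (G t)).det ∈ Q :=
        hJQ (Ideal.mem_sup_right (Ideal.subset_span ⟨e, rfl⟩))
      rw [← hker, RingHom.map_det] at h1
      exact h1
    rw [Fintype.not_linearIndependent_iff] at hM
    obtain ⟨c, hc, t₀, ht₀⟩ := hM
    have hc1 : ∀ l, ∑ t, c t * algebraMap R L (pderiv (Sum.inl l) (G t)) = 0 := fun l => by
      simpa [M, Matrix.row] using congrFun hc l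
    have hc2 : ∀ k, ∑ t, c t * algebraMap R L (pderiv (Sum.inr k) (G t)) = 0 :=
      sum_mul_pderiv_inr_eq_zero (IsScalarTower.toAlgHom ℂ R L) hinj G
        (fun t => (hker _).2 (hGQ t)) c hc1
    obtain ⟨b, hb⟩ := IsLocalization.exist_integer_multiples_of_finite
      (nonZeroDivisors (R ⧸ Q)) c
    choose r' hr' using hb
    choose r hr using fun t => Ideal.Quotient.mk_surjective (r' t)
    have hr2 : ∀ t, algebraMap R L (r t) = algebraMap (R ⧸ Q) L b * c t := fun t => by
      rw [← Algebra.smul_def, IsScalarTower.algebraMap_apply R (R ⧸ Q) L,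
        Ideal.Quotient.algebraMap_eq, hr t, hr' t]
    have hr3 := hfull Q hQ hGQ hΔQ r (fun v => by
      rw [← hker, map_sum]
      simp only [map_mul, hr2, mul_assoc]
      rw [← Finset.mul_sum]
      cases v with
      | inl l => rw [hc1 l, mul_zero]
      | inr k => rw [hc2 k, mul_zero]) t₀
    rw [← hker, hr2] at hr3
    refine (mul_ne_zero ?_ ht₀) hr3
    exact IsLocalization.to_map_ne_zero_of_mem_nonZeroDivisors L le_rfl b.2
  obtain ⟨y, hyJ, hyS⟩ := Set.not_disjoint_iff.1 key
  obtain ⟨_, ⟨m, rfl⟩, _, ⟨f, hf, rfl⟩, rfl⟩ := Submonoid.mem_sup.1 hyS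
  refine ⟨f, nonZeroDivisors.ne_zero hf, fun a ha P hP hGP hΔP => ?_⟩
  by_contra hcon
  have h1 : J ≤ P.comap (specialize a) := by
    refine sup_le (Ideal.span_le.2 ?_) (Ideal.span_le.2 ?_)
    · rintro _ ⟨t, rfl⟩; exact hGP t
    · rintro _ ⟨e, rfl⟩
      by_contra h2
      apply hcon
      refine IndependentDifferentials.of_det_notMem e fun h3 => h2 ?_
      rw [SetLike.mem_coe, Ideal.mem_comap]
      have h4 := (specialize a).toRingHom.map_det
        (Matrix.of fun t u => pderiv (Sum.inl (e u)) (G t))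
      change specialize a _ = _ at h4
      rw [h4]
      convert h3 using 2
      ext t u
      simp [pderiv_specialize]
  have h2 := h1 hyJ
  rw [Ideal.mem_comap] at h2
  change specialize a (Δ ^ m * rename Sum.inr f) ∈ P at h2
  rw [map_mul, map_pow, specialize_rename_inr] at h2
  rcases hP.mem_or_mem h2 with h3 | h3
  · exact hΔP (hP.mem_of_pow_mem _ h3)
  · exact hP.ne_top (P.eq_top_of_isUnit_mem h3 ((isUnit_iff_ne_zero.2 ha).map C))

end GenericSmoothness

section PolarMatrix
open MvPolynomial

/-- The Jacobian of `F` with appended rows `A k - ε X`, the entries of `A` being indeterminates. -/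
noncomputable def genericPolarMatrix {n p : ℕ} (d : ℕ) (F : Fin p → MvPolynomial (Fin n) ℂ)
    (ε : ℂ) : Matrix (Fin p ⊕ Fin d) (Fin n) (MvPolynomial (Fin n ⊕ (Fin d × Fin n)) ℂ) :=
  Matrix.of fun r l => Sum.elim (fun t => rename Sum.inl (pderiv l (F t)))
    (fun k => X (Sum.inr (k, l)) - C ε * X (Sum.inl l)) r

/-- The Jacobian of `F` with appended rows `a k - ε X`: the classic polar matrix for `ε = 0` and
the dual one for `ε = 1`. -/
noncomputable def polarMatrix {n p d : ℕ} (F : Fin p → MvPolynomial (Fin n) ℂ) (ε : ℂ)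
    (a : Fin d × Fin n → ℂ) : Matrix (Fin p ⊕ Fin d) (Fin n) (MvPolynomial (Fin n) ℂ) :=
  Matrix.of fun r l => Sum.elim (fun t => pderiv l (F t)) (fun k => C (a (k, l)) - C ε * X l) r

lemma specialize_rename_inl {n : ℕ} {κ : Type} (a : κ → ℂ) (g : MvPolynomial (Fin n) ℂ) :
    specialize a (rename Sum.inl g) = g := by
  rw [specialize, aeval_rename]
  exact aeval_X_left_apply g

lemma specialize_genericPolarMatrix {n p d : ℕ} (F : Fin p → MvPolynomial (Fin n) ℂ) (ε : ℂ)
    (a : Fin d × Fin n → ℂ) (r : Fin p ⊕ Fin d) (l : Fin n) :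
    specialize a (genericPolarMatrix d F ε r l) = polarMatrix F ε a r l := by
  cases r with
  | inl t => exact specialize_rename_inl a _
  | inr k =>
    simp [genericPolarMatrix, polarMatrix, specialize]

lemma specialize_det {n p d q : ℕ} (F : Fin p → MvPolynomial (Fin n) ℂ) (ε : ℂ)
    (a : Fin d × Fin n → ℂ) (ρ : Fin q → Fin p ⊕ Fin d) (γ : Fin q → Fin n) :
    specialize a ((genericPolarMatrix d F ε).submatrix ρ γ).det =
      ((polarMatrix F ε a).submatrix ρ γ).det := by
  have h := (specialize a).toRingHom.map_det ((genericPolarMatrix d F ε).submatrix ρ γ)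
  change specialize a _ = _ at h
  rw [h]
  congr 1
  exact Matrix.ext fun u v => specialize_genericPolarMatrix F ε a _ _

lemma Derivation.det_eq_zero {A : Type} [CommRing A] [Algebra ℂ A] (D : Derivation ℂ A A) :
    ∀ {q : ℕ} (M : Matrix (Fin q) (Fin q) A), (∀ u v, D (M u v) = 0) → D M.det = 0
  | 0, M, _ => by simp
  | q + 1, M, h => by
    rw [Matrix.det_succ_row_zero, map_sum]
    refine Finset.sum_eq_zero fun j _ => ?_
    rw [Derivation.leibniz, Derivation.leibniz, h,
      D.det_eq_zero (M.submatrix Fin.succ j.succAbove) fun u v => h u.succ (j.succAbove v)]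
    have : D ((-1) ^ (j : ℕ)) = 0 := by
      rw [Derivation.leibniz_pow, map_neg, Derivation.map_one_eq_zero]
      simp
    simp [this]

lemma pderiv_rename_inl {n : ℕ} {κ : Type} (k : κ) (g : MvPolynomial (Fin n) ℂ) :
    pderiv (Sum.inr k) (rename Sum.inl g : MvPolynomial (Fin n ⊕ κ) ℂ) = 0 := by
  classical
  refine pderiv_eq_zero_of_notMem_vars fun h => ?_
  have := vars_rename (Sum.inl : Fin n → Fin n ⊕ κ) g h
  simp at this

lemma pderiv_inl_rename_inl {n : ℕ} {κ : Type} (l : Fin n) (g : MvPolynomial (Fin n) ℂ) :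
    pderiv (Sum.inl l) (rename Sum.inl g : MvPolynomial (Fin n ⊕ κ) ℂ) =
      rename Sum.inl (pderiv l g) :=
  pderiv_rename Sum.inl_injective l g

lemma pderiv_genericPolarMatrix {n p d : ℕ} (F : Fin p → MvPolynomial (Fin n) ℂ) (ε : ℂ)
    (k : Fin d) (j : Fin n) (r : Fin p ⊕ Fin d) (l : Fin n) :
    pderiv (Sum.inr (k, j)) (genericPolarMatrix d F ε r l) =
      if r = Sum.inr k ∧ l = j then 1 else 0 := by
  classical
  cases r with
  | inl t => simpa [genericPolarMatrix] using pderiv_rename_inl (k, j) _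
  | inr k' =>
    simp only [genericPolarMatrix, Matrix.of_apply, Sum.elim_inr, map_sub, pderiv_C_mul, pderiv_X,
      Pi.single_apply, Sum.inr.injEq, Prod.mk.injEq, reduceCtorEq, if_false, mul_zero, sub_zero]

lemma pderiv_det_cons {n p d q : ℕ} (F : Fin p → MvPolynomial (Fin n) ℂ) (ε : ℂ)
    (ρ : Fin q → Fin p ⊕ Fin d) (γ : Fin q → Fin n) (k k' : Fin d) (j j' : Fin n)
    (hk : ∀ u, ρ u ≠ Sum.inr k) (hj : ∀ v, γ v ≠ j) :
    pderiv (Sum.inr (k, j)) ((genericPolarMatrix d F ε).submatrix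
      (Fin.cons (Sum.inr k') ρ : Fin (q + 1) → Fin p ⊕ Fin d)
      (Fin.cons j' γ : Fin (q + 1) → Fin n)).det =
      if k' = k ∧ j' = j then ((genericPolarMatrix d F ε).submatrix ρ γ).det else 0 := by
  split_ifs with h
  · obtain ⟨rfl, rfl⟩ := h
    have hD : ∀ e : Fin q → Fin n, pderiv (Sum.inr (k', j'))
        ((genericPolarMatrix d F ε).submatrix ρ e).det = 0 := fun e => by
      refine Derivation.det_eq_zero _ _ fun u v => ?_
      rw [Matrix.submatrix_apply, pderiv_genericPolarMatrix, if_neg fun h => hk u h.1]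
    rw [Matrix.det_succ_row_zero, Fin.sum_univ_succ]
    simp only [Matrix.submatrix_apply, Fin.cons_zero, Fin.cons_succ, Matrix.submatrix_submatrix]
    rw [map_add, map_sum, Finset.sum_eq_zero, add_zero]
    · have h1 := hD ((Fin.cons j' γ : Fin (q + 1) → Fin n) ∘ Fin.succAbove 0)
      have h2 : (Fin.cons (Sum.inr k') ρ : Fin (q + 1) → Fin p ⊕ Fin d) ∘ Fin.succ = ρ := by
        funext u; simp
      rw [h2, Derivation.leibniz, h1]
      have h3 : (Fin.cons j' γ : Fin (q + 1) → Fin n) ∘ Fin.succAbove 0 = γ := by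
        funext u; simp
      rw [h3]
      simp [pderiv_genericPolarMatrix]
    · intro v _
      have h2 : (Fin.cons (Sum.inr k') ρ : Fin (q + 1) → Fin p ⊕ Fin d) ∘ Fin.succ = ρ := by
        funext u; simp
      rw [h2, Derivation.leibniz, hD, Derivation.leibniz, pderiv_genericPolarMatrix,
        if_neg fun h => hj v h.2, Derivation.leibniz_pow, map_neg, Derivation.map_one_eq_zero]
      simp
  · refine Derivation.det_eq_zero _ _ fun u v => ?_
    rw [Matrix.submatrix_apply, pderiv_genericPolarMatrix, if_neg]
    rintro ⟨h1, h2⟩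
    apply h
    constructor
    · cases u using Fin.cases with
      | zero => simpa using h1
      | succ u => exact absurd (by simpa using h1) (hk u)
    · cases v using Fin.cases with
      | zero => simpa using h2
      | succ v => exact absurd (by simpa using h2) (hj v)


lemma exists_ne_zero_forall {κ ι : Type} [Finite ι] (Q : ι → (κ → ℂ) → Prop)
    (h : ∀ i, ∃ f : MvPolynomial κ ℂ, f ≠ 0 ∧ ∀ a, eval a f ≠ 0 → Q i a) :
    ∃ f : MvPolynomial κ ℂ, f ≠ 0 ∧ ∀ a, eval a f ≠ 0 → ∀ i, Q i a := by
  have := Fintype.ofFinite ι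
  choose f hf hQ using h
  refine ⟨∏ i, f i, Finset.prod_ne_zero_iff.2 fun i _ => hf i, fun a ha i => hQ i a ?_⟩
  rw [map_prod, Finset.prod_ne_zero_iff] at ha
  exact ha i (Finset.mem_univ i)

/-- The equations of `S` together with bordered minors of the polar matrix. -/
noncomputable def borderedFamily {n p d q : ℕ} (F : Fin p → MvPolynomial (Fin n) ℂ) (ε : ℂ)
    (a : Fin d × Fin n → ℂ) (ρ : Fin q → Fin p ⊕ Fin d) (γ : Fin q → Fin n)
    (B : Finset (Fin d × Fin n)) : Fin p ⊕ B → MvPolynomial (Fin n) ℂ :=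
  Sum.elim F fun x => ((polarMatrix F ε a).submatrix
    (Fin.cons (Sum.inr x.1.1) ρ : Fin (q + 1) → Fin p ⊕ Fin d)
    (Fin.cons x.1.2 γ : Fin (q + 1) → Fin n)).det

theorem exists_generic_borderedFamily {n p d q : ℕ} (F : Fin p → MvPolynomial (Fin n) ℂ) (ε : ℂ)
    (ρ : Fin q → Fin p ⊕ Fin d) (γ : Fin q → Fin n) (B : Finset (Fin d × Fin n))
    (hρ : Function.Injective ρ) (hF : ∀ t, ∃ u, ρ u = Sum.inl t)
    (hB : ∀ x ∈ B, (∀ u, ρ u ≠ Sum.inr x.1) ∧ ∀ v, γ v ≠ x.2) :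
    ∃ f : MvPolynomial (Fin d × Fin n) ℂ, f ≠ 0 ∧ ∀ a, eval a f ≠ 0 →
      ∀ P : Ideal (MvPolynomial (Fin n) ℂ), P.IsPrime → (∀ t, borderedFamily F ε a ρ γ B t ∈ P) →
        ((polarMatrix F ε a).submatrix ρ γ).det ∉ P →
        IndependentDifferentials P (borderedFamily F ε a ρ γ B) := by
  classical
  set M := genericPolarMatrix d F ε with hM
  let G : Fin p ⊕ B → MvPolynomial (Fin n ⊕ (Fin d × Fin n)) ℂ :=
    Sum.elim (fun t => rename Sum.inl (F t)) fun x => (M.submatrix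
      (Fin.cons (Sum.inr x.1.1) ρ : Fin (q + 1) → Fin p ⊕ Fin d)
      (Fin.cons x.1.2 γ : Fin (q + 1) → Fin n)).det
  have hG : ∀ a, (fun t => specialize a (G t)) = borderedFamily F ε a ρ γ B := by
    intro a
    funext t
    cases t with
    | inl t => exact specialize_rename_inl a _
    | inr x => exact specialize_det F ε a _ _
  refine Exists.imp ?_ (exists_generic_independentDifferentials G (M.submatrix ρ γ).det ?_)
  · rintro f ⟨hf, h⟩
    refine ⟨hf, fun a ha P hP h1 h2 => ?_⟩
    have h3 := h a ha P hP (fun t => by rw [← hG] at h1; exact h1 t)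
      (by rw [hM, specialize_det]; exact h2)
    rwa [hG] at h3
  · intro Q hQ hGQ hΔ r hr
    have h1 : ∀ x : B, r (Sum.inr x) ∈ Q := by
      intro x
      have h2 := hr (Sum.inr x.1)
      rw [Fintype.sum_sum_type, Finset.sum_eq_zero, zero_add, Finset.sum_eq_single x] at h2
      · have h3 := pderiv_det_cons F ε ρ γ x.1.1 x.1.1 x.1.2 x.1.2 (hB x.1 x.2).1 (hB x.1 x.2).2
        rw [if_pos ⟨rfl, rfl⟩] at h3
        rw [show pderiv (Sum.inr x.1) (G (Sum.inr x)) = _ from h3] at h2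
        exact (hQ.mem_or_mem h2).resolve_right hΔ
      · intro y _ hy
        have h3 := pderiv_det_cons F ε ρ γ x.1.1 y.1.1 x.1.2 y.1.2 (hB x.1 x.2).1 (hB x.1 x.2).2
        rw [if_neg (fun h => hy (Subtype.ext (Prod.ext h.1 h.2)))] at h3
        rw [show pderiv (Sum.inr x.1) (G (Sum.inr y)) = _ from h3, mul_zero]
      · simp
      · intro t _
        rw [show pderiv (Sum.inr x.1) (G (Sum.inl t)) = 0 from pderiv_rename_inl _ _, mul_zero]
    have h2 : ∀ l, ∑ t, r (Sum.inl t) * M (Sum.inl t) l ∈ Q := by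
      intro l
      have h3 := hr (Sum.inl l)
      rw [Fintype.sum_sum_type] at h3
      have h4 := (Q.add_mem_iff_left (Q.sum_mem fun x _ => Q.mul_mem_right _ (h1 x))).1 h3
      convert h4 using 3 with t
      exact (pderiv_inl_rename_inl l (F t)).symm
    have h3 := Matrix.eq_zero_of_vecMul_eq_zero
      (M := (M.submatrix ρ γ).map (Ideal.Quotient.mk Q))
      (v := fun u => Ideal.Quotient.mk Q (Sum.elim (fun t => r (Sum.inl t)) (fun _ => 0) (ρ u)))
      (by
        rw [← RingHom.mapMatrix_apply, ← RingHom.map_det, Ne, Ideal.Quotient.eq_zero_iff_mem]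
        exact hΔ)
      (by
        funext v
        have h4 := h2 (γ v)
        have h5 : ∑ t, r (Sum.inl t) * M (Sum.inl t) (γ v) =
            ∑ u, Sum.elim (fun t => r (Sum.inl t)) (fun _ => 0) (ρ u) * M (ρ u) (γ v) := by
          let φ : Fin p ⊕ Fin d → MvPolynomial (Fin n ⊕ (Fin d × Fin n)) ℂ := fun x =>
            Sum.elim (fun t => r (Sum.inl t)) (fun _ => 0) x * M x (γ v)
          have h6 : ∑ u, φ (ρ u) = ∑ x, φ x := by
            rw [← Finset.sum_image (f := φ) (s := Finset.univ) (g := ρ) (fun _ _ _ _ h => hρ h)]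
            refine Finset.sum_subset (Finset.subset_univ _) fun x _ hx => ?_
            cases x with
            | inl t =>
              obtain ⟨u, hu⟩ := hF t
              exact absurd (Finset.mem_image.2 ⟨u, Finset.mem_univ _, hu⟩) hx
            | inr k => exact zero_mul _
          refine Eq.trans ?_ h6.symm
          rw [Fintype.sum_sum_type]
          simp [φ]
        rw [h5, ← Ideal.Quotient.eq_zero_iff_mem, map_sum] at h4
        simpa [Matrix.vecMul, dotProduct] using h4)
    intro t
    cases t with
    | inl t =>
      obtain ⟨u, hu⟩ := hF t
      have h4 := congrFun h3 u
      rw [hu] at h4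
      exact Ideal.Quotient.eq_zero_iff_mem.1 h4
    | inr x => exact h1 x

end PolarMatrix

section PolarHeights
open MvPolynomial

/-- All bordered families have independent differentials wherever they vanish and the bordered
minor does not. -/
def PolarGeneric {n p d : ℕ} (F : Fin p → MvPolynomial (Fin n) ℂ) (ε : ℂ)
    (a : Fin d × Fin n → ℂ) : Prop :=
  ∀ (q : ℕ) (ρ : Fin q → Fin p ⊕ Fin d) (γ : Fin q → Fin n) (B : Finset (Fin d × Fin n)),
    Function.Injective ρ → (∀ t, ∃ u, ρ u = Sum.inl t) →
    (∀ x ∈ B, (∀ u, ρ u ≠ Sum.inr x.1) ∧ ∀ v, γ v ≠ x.2) →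
    ∀ P : Ideal (MvPolynomial (Fin n) ℂ), P.IsPrime → (∀ t, borderedFamily F ε a ρ γ B t ∈ P) →
      ((polarMatrix F ε a).submatrix ρ γ).det ∉ P →
      IndependentDifferentials P (borderedFamily F ε a ρ γ B)

theorem exists_polarGeneric {n p d : ℕ} (F : Fin p → MvPolynomial (Fin n) ℂ) (ε : ℂ) :
    ∃ f : MvPolynomial (Fin d × Fin n) ℂ, f ≠ 0 ∧ ∀ a, eval a f ≠ 0 → PolarGeneric F ε a := by
  classical
  obtain ⟨f, hf, h⟩ := exists_ne_zero_forall
    (ι := Σ q : Fin (p + d + 1), (Fin q → Fin p ⊕ Fin d) × (Fin q → Fin n) ×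
      Finset (Fin d × Fin n))
    (fun i a => Function.Injective i.2.1 → (∀ t, ∃ u, i.2.1 u = Sum.inl t) →
      (∀ x ∈ i.2.2.2, (∀ u, i.2.1 u ≠ Sum.inr x.1) ∧ ∀ v, i.2.2.1 v ≠ x.2) →
      ∀ P : Ideal (MvPolynomial (Fin n) ℂ), P.IsPrime →
        (∀ t, borderedFamily F ε a i.2.1 i.2.2.1 i.2.2.2 t ∈ P) →
        ((polarMatrix F ε a).submatrix i.2.1 i.2.2.1).det ∉ P →
        IndependentDifferentials P (borderedFamily F ε a i.2.1 i.2.2.1 i.2.2.2)) (by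
      rintro ⟨q, ρ, γ, B⟩
      by_cases h : Function.Injective ρ ∧ (∀ t, ∃ u, ρ u = Sum.inl t) ∧
        (∀ x ∈ B, (∀ u, ρ u ≠ Sum.inr x.1) ∧ ∀ v, γ v ≠ x.2)
      · obtain ⟨f, hf, h⟩ := exists_generic_borderedFamily F ε ρ γ B h.1 h.2.1 h.2.2
        exact ⟨f, hf, fun a ha _ _ _ => h a ha⟩
      · exact ⟨1, one_ne_zero, fun a _ h1 h2 h3 => absurd ⟨h1, h2, h3⟩ h⟩)
  refine ⟨f, hf, fun a ha q ρ γ B hρ => ?_⟩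
  have hq : q < p + d + 1 := by
    have := Fintype.card_le_of_injective ρ hρ
    simp at this
    omega
  exact h a ha ⟨⟨q, hq⟩, ρ, γ, B⟩ hρ

/-- The rows of the polar matrix coming from the Jacobian and from the first `m` further rows. -/
def RowLt {p d : ℕ} (m : ℕ) (r : Fin p ⊕ Fin d) : Prop :=
  ∀ k, r = Sum.inr k → k.val < m

noncomputable def polarMinorIdeal {n p d : ℕ} (F : Fin p → MvPolynomial (Fin n) ℂ) (ε : ℂ)
    (a : Fin d × Fin n → ℂ) (m : ℕ) (L : Set (Fin n)) : Ideal (MvPolynomial (Fin n) ℂ) :=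
  Ideal.span (Set.range F) ⊔ Ideal.span {x | ∃ (ρ : Fin (p + m) → Fin p ⊕ Fin d)
    (γ : Fin (p + m) → Fin n), Function.Injective ρ ∧ (∀ u, RowLt m (ρ u)) ∧ (∀ v, γ v ∈ L) ∧
    x = ((polarMatrix F ε a).submatrix ρ γ).det}

variable {n p d : ℕ} {F : Fin p → MvPolynomial (Fin n) ℂ} {ε : ℂ} {a : Fin d × Fin n → ℂ}

lemma mem_polarMinorIdeal_of_mem (m : ℕ) (L : Set (Fin n)) (t : Fin p) :
    F t ∈ polarMinorIdeal F ε a m L :=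
  Ideal.mem_sup_left (Ideal.subset_span ⟨t, rfl⟩)

lemma det_mem_polarMinorIdeal {m q : ℕ} {L : Set (Fin n)} {ρ : Fin q → Fin p ⊕ Fin d}
    {γ : Fin q → Fin n} (hq : q = p + m) (hρ : Function.Injective ρ) (h : ∀ u, RowLt m (ρ u))
    (hγ : ∀ v, γ v ∈ L) :
    ((polarMatrix F ε a).submatrix ρ γ).det ∈ polarMinorIdeal F ε a m L := by
  subst hq
  exact Ideal.mem_sup_right (Ideal.subset_span ⟨ρ, γ, hρ, h, hγ, rfl⟩)

lemma card_le_of_rowLt {m q : ℕ} {ρ : Fin q → Fin p ⊕ Fin d} (hρ : Function.Injective ρ)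
    (h : ∀ u, RowLt m (ρ u)) : q ≤ p + m := by
  have hex : ∀ u, ∃ y : Fin p ⊕ Fin m, Sum.map Fin.val Fin.val y =
      (Sum.map Fin.val Fin.val (ρ u) : ℕ ⊕ ℕ) := by
    intro u
    rcases hu : ρ u with t | k
    · exact ⟨Sum.inl t, rfl⟩
    · exact ⟨Sum.inr ⟨k, h u k hu⟩, rfl⟩
  choose g hg using hex
  have hinj : Function.Injective g := by
    intro u u' huu
    apply hρ
    have := (hg u).symm.trans ((congrArg _ huu).trans (hg u'))
    exact Sum.map_injective.2 ⟨Fin.val_injective, Fin.val_injective⟩ this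
  simpa using Fintype.card_le_of_injective g hinj

/-- A minor of maximal size not contained in `P`, among those containing the Jacobian rows. -/
structure IsMaximalMinor (P : Ideal (MvPolynomial (Fin n) ℂ)) (F : Fin p → MvPolynomial (Fin n) ℂ)
    (ε : ℂ) (a : Fin d × Fin n → ℂ) (m : ℕ) (L : Set (Fin n)) {q : ℕ} (ρ : Fin q → Fin p ⊕ Fin d)
    (γ : Fin q → Fin n) : Prop where
  inj : Function.Injective ρ
  covers : ∀ t, ∃ u, ρ u = Sum.inl t
  rowLt : ∀ u, RowLt m (ρ u)
  mem : ∀ v, γ v ∈ L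
  notMem : ((polarMatrix F ε a).submatrix ρ γ).det ∉ P
  bordered : ∀ k : Fin d, k.val < m → (∀ u, ρ u ≠ Sum.inr k) → ∀ j ∈ L,
    ((polarMatrix F ε a).submatrix (Fin.cons (Sum.inr k) ρ : Fin (q + 1) → Fin p ⊕ Fin d)
      (Fin.cons j γ : Fin (q + 1) → Fin n)).det ∈ P

lemma exists_isMaximalMinor {P : Ideal (MvPolynomial (Fin n) ℂ)} {m : ℕ} {L : Set (Fin n)}
    {E : Fin p → Fin n} (hE : ∀ t, E t ∈ L)
    (hEP : ((polarMatrix F ε a).submatrix Sum.inl E).det ∉ P)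
    (hP : polarMinorIdeal F ε a m L ≤ P) :
    ∃ q, q < p + m ∧ ∃ (ρ : Fin q → Fin p ⊕ Fin d) (γ : Fin q → Fin n),
      IsMaximalMinor P F ε a m L ρ γ := by
  classical
  let good : ℕ → Prop := fun q => ∃ (ρ : Fin q → Fin p ⊕ Fin d) (γ : Fin q → Fin n),
    Function.Injective ρ ∧ (∀ t, ∃ u, ρ u = Sum.inl t) ∧ (∀ u, RowLt m (ρ u)) ∧
    (∀ v, γ v ∈ L) ∧ ((polarMatrix F ε a).submatrix ρ γ).det ∉ P
  have h0 : good p := ⟨Sum.inl, E, Sum.inl_injective, fun t => ⟨t, rfl⟩,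
    fun u k h => by simp at h, hE, hEP⟩
  have hle : ∀ q, good q → q ≤ p + m := fun q ⟨ρ, γ, h1, _, h2, _⟩ => card_le_of_rowLt h1 h2
  set q := Nat.findGreatest good (p + m) with hq
  have hgood : good q := Nat.findGreatest_spec (hle p h0) h0
  have hmax : ¬ good (q + 1) := fun h => by
    have := Nat.le_findGreatest (hle _ h) h
    omega
  obtain ⟨ρ, γ, h1, h2, h3, h4, h5⟩ := hgood
  have hlt : q < p + m := lt_of_le_of_ne (card_le_of_rowLt h1 h3) fun h =>
    h5 (hP (det_mem_polarMinorIdeal h h1 h3 h4))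
  refine ⟨q, hlt, ρ, γ, h1, h2, h3, h4, h5, fun k hk hk' j hj => ?_⟩
  by_contra hcon
  refine hmax ⟨_, _, ?_, ?_, ?_, ?_, hcon⟩
  · rw [Fin.cons_injective_iff]
    exact ⟨by rintro ⟨u, hu⟩; exact hk' u hu, h1⟩
  · intro t
    obtain ⟨u, hu⟩ := h2 t
    exact ⟨u.succ, by simpa using hu⟩
  · intro u
    cases u using Fin.cases with
    | zero =>
      intro k' h
      rw [Fin.cons_zero] at h
      exact (Sum.inr_injective h) ▸ hk
    | succ u => simpa using h3 u
  · intro v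
    cases v using Fin.cases with
    | zero => simpa using hj
    | succ v => simpa using h4 v

namespace IsMaximalMinor
variable {P : Ideal (MvPolynomial (Fin n) ℂ)} {m q : ℕ} {L : Set (Fin n)}
  {ρ : Fin q → Fin p ⊕ Fin d} {γ : Fin q → Fin n}

lemma injective_right (h : IsMaximalMinor P F ε a m L ρ γ) : Function.Injective γ := by
  intro v v' hv
  by_contra hne
  apply h.notMem
  rw [Matrix.det_zero_of_column_eq hne (fun u => by simp [hv])]
  exact P.zero_mem

lemma le_card (h : IsMaximalMinor P F ε a m L ρ γ) : p ≤ q := by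
  choose g hg using h.covers
  have := Fintype.card_le_of_injective g fun t t' htt =>
    Sum.inl_injective ((hg t).symm.trans ((congrArg ρ htt).trans (hg t')))
  simpa using this

lemma card_rows (h : IsMaximalMinor P F ε a m L ρ γ) (hm : m ≤ d) :
    p + m - q ≤ (Finset.univ.filter fun k : Fin d => k.val < m ∧ ∀ u, ρ u ≠ Sum.inr k).card := by
  classical
  have h1 : (Finset.univ.image (Sum.map id (Fin.castLE hm) : Fin p ⊕ Fin m → Fin p ⊕ Fin d)) ⊆
      Finset.univ.image ρ ∪ (Finset.univ.filter
        fun k : Fin d => k.val < m ∧ ∀ u, ρ u ≠ Sum.inr k).image Sum.inr := by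
    intro x hx
    obtain ⟨y, -, rfl⟩ := Finset.mem_image.1 hx
    rw [Finset.mem_union]
    by_cases hy : ∃ u, ρ u = Sum.map id (Fin.castLE hm) y
    · obtain ⟨u, hu⟩ := hy
      exact Or.inl (Finset.mem_image.2 ⟨u, Finset.mem_univ _, hu⟩)
    · cases y with
      | inl t => exact absurd (h.covers t) hy
      | inr k =>
        refine Or.inr (Finset.mem_image.2 ⟨Fin.castLE hm k, ?_, rfl⟩)
        simp only [Finset.mem_filter, Finset.mem_univ, true_and]
        exact ⟨by simp, fun u hu => hy ⟨u, hu⟩⟩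
  have h2 := (Finset.card_le_card h1).trans (Finset.card_union_le _ _)
  rw [Finset.card_image_of_injective _ (Sum.map_injective.2
    ⟨Function.injective_id, Fin.castLE_injective hm⟩),
    Finset.card_image_of_injective _ h.inj,
    Finset.card_image_of_injective _ Sum.inr_injective] at h2
  simp only [Finset.card_univ, Fintype.card_sum, Fintype.card_fin] at h2
  omega

theorem independentDifferentials (h : IsMaximalMinor P F ε a m L ρ γ) [hP : P.IsPrime]
    (hgen : PolarGeneric F ε a) (hF : ∀ t, F t ∈ P) {B : Finset (Fin d × Fin n)}
    (hB : ∀ x ∈ B, x.1.val < m ∧ (∀ u, ρ u ≠ Sum.inr x.1) ∧ x.2 ∈ L ∧ ∀ v, γ v ≠ x.2) :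
    (∀ t, borderedFamily F ε a ρ γ B t ∈ P) ∧
      IndependentDifferentials P (borderedFamily F ε a ρ γ B) := by
  have h1 : ∀ t, borderedFamily F ε a ρ γ B t ∈ P := by
    intro t
    cases t with
    | inl t => exact hF t
    | inr x =>
      obtain ⟨h1, h2, h3, -⟩ := hB x.1 x.2
      exact h.bordered x.1.1 h1 h2 x.1.2 h3
  exact ⟨h1, hgen q ρ γ B h.inj h.covers (fun x hx => ⟨(hB x hx).2.1, (hB x hx).2.2.2⟩) P hP h1
    h.notMem⟩

theorem add_mul_le_height (h : IsMaximalMinor P F ε a m L ρ γ) [hP : P.IsPrime] (hm : m ≤ d)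
    (hgen : PolarGeneric F ε a) (hF : ∀ t, F t ∈ P) {c : ℕ} (hc : c ≤ L.ncard) :
    ((p + (p + m - q) * (c - q) : ℕ) : ℕ∞) ≤ P.height := by
  classical
  set K := Finset.univ.filter fun k : Fin d => k.val < m ∧ ∀ u, ρ u ≠ Sum.inr k with hK
  set C := Finset.univ.filter fun j : Fin n => j ∈ L ∧ ∀ v, γ v ≠ j with hC
  obtain ⟨h1, h2⟩ := h.independentDifferentials hgen hF (B := K ×ˢ C) (fun x hx => by
    simp only [Finset.mem_product, hK, hC, Finset.mem_filter, Finset.mem_univ, true_and] at hx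
    exact ⟨hx.1.1, hx.1.2, hx.2.1, hx.2.2⟩)
  refine le_trans ?_ (h2.card_le_height h1)
  have hcC : c - q ≤ C.card := by
    have h3 : Finset.univ.filter (fun j : Fin n => j ∈ L) ⊆ Finset.univ.image γ ∪ C := by
      intro j hj
      simp only [Finset.mem_filter, Finset.mem_univ, true_and] at hj
      simp only [Finset.mem_union, Finset.mem_image, Finset.mem_univ, true_and, hC,
        Finset.mem_filter]
      by_cases h : ∃ v, γ v = j
      · exact Or.inl h
      · exact Or.inr ⟨hj, fun v hv => h ⟨v, hv⟩⟩
    have h4 := (Finset.card_le_card h3).trans (Finset.card_union_le _ _)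
    have h5 : L.ncard = (Finset.univ.filter (fun j : Fin n => j ∈ L)).card := by
      rw [← Set.ncard_coe_finset]
      congr 1
      ext j
      simp
    have h6 : (Finset.univ.image γ).card ≤ q := by
      simpa using Finset.card_image_le (s := (Finset.univ : Finset (Fin q))) (f := γ)
    omega
  rw [Fintype.card_sum, Fintype.card_coe, Finset.card_product, Fintype.card_fin]
  exact_mod_cast Nat.add_le_add_left (Nat.mul_le_mul (h.card_rows hm) hcC) p

end IsMaximalMinor

end PolarHeights

section PolarLocal
open MvPolynomial

lemma map_leadingMinor {T T' : Type} [CommRing T] [CommRing T'] (φ : T →+* T') (X : ℕ → ℕ → T)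
    {s : ℕ} (g : Fin s → ℕ) :
    φ (leadingMinor X s g) = leadingMinor (fun i j => φ (X i j)) s g := by
  rw [leadingMinor, leadingMinor, RingHom.map_det]
  rfl

lemma map_leadingMinorIdeal {T T' : Type} [CommRing T] [CommRing T'] (φ : T →+* T') (f : Ideal T)
    (X : ℕ → ℕ → T) (s c : ℕ) :
    (leadingMinorIdeal f X s c).map φ =
      leadingMinorIdeal (f.map φ) (fun i j => φ (X i j)) s c := by
  rw [leadingMinorIdeal, leadingMinorIdeal, Ideal.map_sup, Ideal.map_span, ← Set.range_comp]
  congr 3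
  funext g
  exact map_leadingMinor φ X _

/-- The entries of the polar matrix, with columns permuted by `σ` and extended by zero. -/
noncomputable def polarEntry {n p d : ℕ} (F : Fin p → MvPolynomial (Fin n) ℂ) (ε : ℂ)
    (a : Fin d × Fin n → ℂ) (σ : Equiv.Perm (Fin n)) (t c : ℕ) : MvPolynomial (Fin n) ℂ :=
  if h : t < p + d ∧ c < n then
    polarMatrix F ε a (finSumFinEquiv.symm ⟨t, h.1⟩) (σ ⟨c, h.2⟩) else 0

variable {n p d : ℕ} {F : Fin p → MvPolynomial (Fin n) ℂ} {ε : ℂ} {a : Fin d × Fin n → ℂ}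

lemma leadingMinor_polarEntry (σ : Equiv.Perm (Fin n)) {s c : ℕ} (hs : s ≤ p + d) (hc : c ≤ n)
    (g : Fin s → Fin c) :
    leadingMinor (polarEntry F ε a σ) s (fun j => g j) =
      ((polarMatrix F ε a).submatrix (finSumFinEquiv.symm ∘ Fin.castLE hs)
        (σ ∘ Fin.castLE hc ∘ g)).det := by
  rw [leadingMinor]
  congr 1
  ext1 u v
  have h : u.val < p + d ∧ (g v).val < n := ⟨by omega, by omega⟩
  simp only [Matrix.of_apply, polarEntry, dif_pos h]
  rfl

lemma rowLt_iff {m : ℕ} {r : Fin p ⊕ Fin d} : RowLt m r ↔ (finSumFinEquiv r).val < p + m := by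
  cases r with
  | inl t => simp [RowLt]; omega
  | inr k => simp [RowLt]

lemma leadingMinorIdeal_polarEntry (σ : Equiv.Perm (Fin n)) {m c : ℕ} (hm : m ≤ d) (hc : c ≤ n) :
    leadingMinorIdeal (Ideal.span (Set.range F)) (polarEntry F ε a σ) (p + m) c =
      polarMinorIdeal F ε a m {j | (σ.symm j).val < c} := by
  have hs : p + m ≤ p + d := by omega
  rw [leadingMinorIdeal, polarMinorIdeal]
  apply le_antisymm
  · refine sup_le le_sup_left (le_sup_of_le_right (Ideal.span_mono ?_))
    rintro _ ⟨g, rfl⟩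
    refine ⟨_, _, ?_, ?_, ?_, leadingMinor_polarEntry σ hs hc g⟩
    · exact finSumFinEquiv.symm.injective.comp (Fin.castLE_injective hs)
    · intro u
      simp [rowLt_iff]
    · intro v
      simp
  · refine sup_le le_sup_left (le_sup_of_le_right (Ideal.span_le.2 ?_))
    rintro _ ⟨ρ, γ, hρ, hr, hγ, rfl⟩
    let τ : Fin (p + m) → Fin (p + m) := fun u => ⟨finSumFinEquiv (ρ u), rowLt_iff.1 (hr u)⟩
    have hτ : Function.Injective τ := fun u u' h => hρ (finSumFinEquiv.injective
      (Fin.ext (Fin.mk.inj_iff.1 h)))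
    let e := Equiv.ofBijective τ (Finite.injective_iff_bijective.1 hτ)
    let g : Fin (p + m) → Fin c := fun v => ⟨σ.symm (γ v), hγ v⟩
    have h1 : (polarMatrix F ε a).submatrix ρ γ = ((polarMatrix F ε a).submatrix
        (finSumFinEquiv.symm ∘ Fin.castLE hs) (σ ∘ Fin.castLE hc ∘ g)).submatrix e id := by
      ext1 u v
      have h2 : finSumFinEquiv.symm (Fin.castLE hs (e u)) = ρ u := by
        rw [Equiv.symm_apply_eq]
        rfl
      have h3 : σ (Fin.castLE hc (g v)) = γ v := by
        rw [← Equiv.eq_symm_apply]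
        rfl
      simp only [Matrix.submatrix_apply, Function.comp_apply, id, h2, h3]
    rw [h1, Matrix.det_permute, ← leadingMinor_polarEntry]
    exact Ideal.mul_mem_left _ _ (Ideal.subset_span ⟨g, rfl⟩)

end PolarLocal

section PolarCodimDepth
open MvPolynomial

lemma IndependentDifferentials.comp {n : ℕ} {τ τ' : Type} [Fintype τ] [Fintype τ']
    {P : Ideal (MvPolynomial (Fin n) ℂ)} {G : τ → MvPolynomial (Fin n) ℂ}
    (h : IndependentDifferentials P G) {e : τ' → τ} (he : Function.Injective e) :
    IndependentDifferentials P (G ∘ e) := by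
  classical
  intro r hr t'
  have h1 := h (Function.extend e r 0) (fun l => ?_) (e t')
  · rwa [he.extend_apply] at h1
  · convert hr l using 1
    have h2 : ∑ t ∈ Finset.univ.image e, Function.extend e r 0 t * pderiv l (G t) =
        ∑ t, Function.extend e r 0 t * pderiv l (G t) := by
      refine Finset.sum_subset (Finset.subset_univ _) fun t _ ht => ?_
      rw [Function.extend_apply' _ _ _ fun ⟨u, hu⟩ =>
        ht (Finset.mem_image.2 ⟨u, Finset.mem_univ _, hu⟩), Pi.zero_apply, zero_mul]
    rw [← h2, Finset.sum_image fun _ _ _ _ h => he h]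
    simp [he.extend_apply]

lemma exists_perm_apply_eq {n p : ℕ} (hp : p ≤ n) {E : Fin p → Fin n} (hE : Function.Injective E) :
    ∃ σ : Equiv.Perm (Fin n), ∀ t, σ (Fin.castLE hp t) = E t := by
  classical
  let e := (Equiv.ofInjective _ (Fin.castLE_injective hp)).symm.trans (Equiv.ofInjective E hE)
  refine ⟨e.extendSubtype, fun t => ?_⟩
  rw [Equiv.extendSubtype_apply_of_mem _ _ ⟨t, rfl⟩]
  simp [e]

variable {n p d : ℕ} {F : Fin p → MvPolynomial (Fin n) ℂ} {ε : ℂ} {a : Fin d × Fin n → ℂ}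

lemma IsLocalization.AtPrime.under_le {R T : Type} [CommRing R] [CommRing T] [Algebra R T]
    (P : Ideal R) [P.IsPrime] [IsLocalization.AtPrime T P] (Q : Ideal T) [Q.IsPrime] :
    Q.under R ≤ P := by
  have h := (IsLocalization.isPrime_iff_isPrime_disjoint P.primeCompl T Q).1 inferInstance
  intro x hx
  by_contra hxP
  exact Set.disjoint_left.1 h.2 hxP hx

theorem codimDepth_quotient_map_span {P : Ideal (MvPolynomial (Fin n) ℂ)} [P.IsPrime]
    {E : Fin p → Fin n} (hE : (Matrix.of fun t u => pderiv (E u) (F t)).det ∉ P) :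
    CodimDepth (Localization.AtPrime P) p (Localization.AtPrime P ⧸
      (Ideal.span (Set.range F)).map (algebraMap _ (Localization.AtPrime P))) := by
  set T := Localization.AtPrime P
  have key : ∀ k ≤ p, CodimDepth T k (T ⧸ (Ideal.span (F '' {t | t.val < k})).map
      (algebraMap (MvPolynomial (Fin n) ℂ) T)) := by
    intro k
    induction k with
    | zero =>
      intro _
      have h0 : CodimDepth T 0 T := ((MvPolynomial.hasGradeEqHeight ℂ n).of_isLocalization
        P.primeCompl).codimDepth
      refine CodimDepth.congr (Submodule.quotEquivOfEqBot _ ?_).symm h0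
      simp
    | succ k ih =>
      intro hk
      have h1 := ih (by omega)
      set I := (Ideal.span (F '' {t | t.val < k})).map (algebraMap (MvPolynomial (Fin n) ℂ) T)
        with hI
      have h2 : (Ideal.span (F '' {t | t.val < k + 1})).map
          (algebraMap (MvPolynomial (Fin n) ℂ) T) =
          I ⊔ Ideal.span {algebraMap _ T (F ⟨k, hk⟩)} := by
        rw [hI, Ideal.map_span, Ideal.map_span, ← Ideal.span_union]
        congr 1
        ext x
        simp only [Set.mem_image, Set.mem_ofPred_eq, Set.mem_union, Set.mem_singleton_iff]
        constructor
        · rintro ⟨_, ⟨t, ht, rfl⟩, rfl⟩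
          rcases Nat.lt_succ_iff_lt_or_eq.1 ht with h | h
          · exact Or.inl ⟨_, ⟨t, h, rfl⟩, rfl⟩
          · right
            rw [show t = ⟨k, hk⟩ from Fin.ext h]
        · rintro (⟨_, ⟨t, ht, rfl⟩, rfl⟩ | rfl)
          · exact ⟨_, ⟨t, by omega, rfl⟩, rfl⟩
          · exact ⟨_, ⟨_, Nat.lt_succ_self k, rfl⟩, rfl⟩
      rw [h2]
      refine h1.quotient_sup_span_singleton fun y => ?_
      refine mem_of_mul_mem_of_notMem_associatedPrimes fun Q hQ hkQ => ?_
      have hQp : Q.IsPrime := hQ.isPrime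
      have h3 := h1.height_le_of_isAssociatedPrime hQ
      have h4 := le_of_isAssociatedPrime_quotient hQ
      have h5 : (Matrix.of fun t u => pderiv (E u) (F t)).det ∉
          Q.under (MvPolynomial (Fin n) ℂ) := fun h =>
        hE (IsLocalization.AtPrime.under_le P Q h)
      have h6 := (IndependentDifferentials.of_det_notMem E h5).comp (Fin.castLE_injective hk)
      have h7 := h6.card_le_height fun t => by
        rcases Nat.lt_succ_iff_lt_or_eq.1 t.2 with h | h
        · exact h4 (Ideal.mem_map_of_mem _ (Ideal.subset_span ⟨_, h, rfl⟩))
        · rwa [Function.comp_apply, show Fin.castLE hk t = ⟨k, hk⟩ from Fin.ext h]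
      rw [IsLocalization.height_under P.primeCompl, Fintype.card_fin] at h7
      exact absurd (h7.trans h3) (by norm_cast; omega)
  have := key p le_rfl
  rwa [show {t : Fin p | t.val < p} = Set.univ from Set.eq_univ_of_forall fun t => t.2,
    Set.image_univ] at this

theorem codimDepth_quotient_map_polarMinorIdeal (hd : p + d = n) (hgen : PolarGeneric F ε a)
    {P : Ideal (MvPolynomial (Fin n) ℂ)} [P.IsPrime]
    {E : Fin p → Fin n} (hE : (Matrix.of fun t u => pderiv (E u) (F t)).det ∉ P) {m : ℕ}
    (hm : m ≤ d) :
    CodimDepth (Localization.AtPrime P) (p + n + 1 - (p + m)) (Localization.AtPrime P ⧸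
      (polarMinorIdeal F ε a m Set.univ).map (algebraMap _ (Localization.AtPrime P))) := by
  have hpn : p ≤ n := by omega
  have hEi : Function.Injective E := by
    intro u u' h
    by_contra hne
    apply hE
    rw [Matrix.det_zero_of_column_eq hne fun t => by simp [h]]
    exact P.zero_mem
  obtain ⟨σ, hσ⟩ := exists_perm_apply_eq hpn hEi
  have h1 := CodimDepth.quotient_leadingMinorIdeal
    ((Ideal.span (Set.range F)).map (algebraMap _ (Localization.AtPrime P)))
    (fun t c => algebraMap _ (Localization.AtPrime P) (polarEntry F ε a σ t c)) (n := n)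
    (codimDepth_quotient_map_span hE) ?_ ?_ n le_rfl (p + m) (by omega) (by omega)
  · rw [← map_leadingMinorIdeal, leadingMinorIdeal_polarEntry σ hm le_rfl] at h1
    rwa [show {j : Fin n | (σ.symm j).val < n} = Set.univ from
      Set.eq_univ_of_forall fun j => (σ.symm j).2] at h1
  · refine Ideal.eq_top_of_isUnit_mem _ (leadingMinor_mem _ _ (fun t : Fin p => t.val)
      fun t => t.2) ?_
    have h2 := leadingMinor_polarEntry (F := F) (ε := ε) (a := a) σ (s := p) (by omega) hpn id
    have h3 : (finSumFinEquiv.symm ∘ Fin.castLE (by omega) : Fin p → Fin p ⊕ Fin d) =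
        Sum.inl := by
      funext t
      exact finSumFinEquiv_symm_apply_castAdd t
    rw [h3] at h2
    rw [← map_leadingMinor]
    refine IsLocalization.map_units (M := P.primeCompl) _ ⟨_, ?_⟩
    change leadingMinor (polarEntry F ε a σ) p (fun t => ((id t : Fin p) : ℕ)) ∉ P
    rw [h2]
    convert hE using 3
    ext1 t u
    simp [hσ, polarMatrix]
  · intro s c hs hsc hc Q hQ hle
    obtain ⟨m', rfl⟩ := Nat.exists_eq_add_of_le hs
    have hm' : m' ≤ d := by omega
    rw [← map_leadingMinorIdeal, leadingMinorIdeal_polarEntry σ hm' hc,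
      Ideal.map_le_iff_le_comap] at hle
    change _ ≤ Q.under _ at hle
    rw [← IsLocalization.height_under P.primeCompl]
    have hE' : (Matrix.of fun t u => pderiv (E u) (F t)).det ∉
        Q.under (MvPolynomial (Fin n) ℂ) := fun h => hE (IsLocalization.AtPrime.under_le P Q h)
    obtain ⟨q, hq, ρ, γ, hmax⟩ := exists_isMaximalMinor (E := E) (fun t => by
      rw [Set.mem_ofPred_eq, ← hσ, Equiv.symm_apply_apply, Fin.val_castLE]
      omega) hE' hle
    have h2 := hmax.add_mul_le_height hm' hgen (fun t => hle (mem_polarMinorIdeal_of_mem m' _ t))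
      (c := c) (by
        have h2 : σ ∘ Fin.castLE hc '' Set.univ ⊆ {j | (σ.symm j).val < c} := by
          rintro _ ⟨j, -, rfl⟩
          simp
        have h3 := Set.ncard_le_ncard h2
        rwa [Set.ncard_image_of_injective _ (σ.injective.comp (Fin.castLE_injective hc)),
          Set.ncard_univ, Nat.card_fin] at h3)
    refine le_trans ?_ h2
    norm_cast
    have h3 := hmax.le_card
    obtain ⟨x, hx⟩ := Nat.exists_eq_add_of_lt hq
    obtain ⟨y, rfl⟩ := Nat.exists_eq_add_of_le hsc
    rw [show p + m' - q = x + 1 by omega, show p + m' + y - q = x + 1 + y by omega]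
    have : x + 1 + y ≤ (x + 1) * (x + 1 + y) := Nat.le_mul_of_pos_left _ (by omega)
    omega

end PolarCodimDepth

section AssociatedPrime

lemma Ideal.exists_isPrime_mem_iff_mul_mem {R : Type} [CommRing R] [IsNoetherianRing R]
    {I : Ideal R} {b : R} (hb : b ∉ I) :
    ∃ (r : R) (P : Ideal R), P.IsPrime ∧ r * b ∉ I ∧ ∀ x, x ∈ P ↔ x * (r * b) ∈ I := by
  let J : Ideal R := Submodule.comap (LinearMap.mulRight R b) I
  have hJ : ∀ x, x ∈ J ↔ x * b ∈ I := fun x => Iff.rfl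
  have : Nontrivial (R ⧸ J) := Ideal.Quotient.nontrivial_iff.2 fun h => hb (by
    have h1 : (1 : R) ∈ J := h ▸ Submodule.mem_top
    simpa using (hJ 1).1 h1)
  obtain ⟨P, hP⟩ := associatedPrimes.nonempty R (R ⧸ J)
  obtain ⟨hp, y, hy⟩ := isAssociatedPrime_iff.1 hP
  obtain ⟨r, rfl⟩ := Ideal.Quotient.mk_surjective y
  have h1 : ∀ x, x ∈ P ↔ x * (r * b) ∈ I := by
    intro x
    rw [hy, Submodule.mem_colon_singleton, Submodule.mem_bot, ← mul_assoc, ← hJ,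
      ← Ideal.Quotient.eq_zero_iff_mem, map_mul]
    rfl
  refine ⟨r, P, hp, fun h => ?_, h1⟩
  exact hp.ne_top ((Ideal.eq_top_iff_one P).2 ((h1 1).2 (by rwa [one_mul])))

lemma CodimDepth.height_le_of_forall_mem_iff {R : Type} [CommRing R] [IsNoetherianRing R]
    {I Q : Ideal R} [Q.IsPrime] {y : R} {c : ℕ} (hy : ∀ x, x ∈ Q ↔ x * y ∈ I)
    (h : CodimDepth (Localization.AtPrime Q) c
      (Localization.AtPrime Q ⧸ I.map (algebraMap R (Localization.AtPrime Q)))) :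
    Q.height ≤ c := by
  set T := Localization.AtPrime Q
  have : IsNoetherianRing T := IsLocalization.isNoetherianRing Q.primeCompl T inferInstance
  have h1 : IsAssociatedPrime (IsLocalRing.maximalIdeal T) (T ⧸ I.map (algebraMap R T)) := by
    refine isAssociatedPrime_iff.2 ⟨inferInstance, Ideal.Quotient.mk _ (algebraMap R T y), ?_⟩
    ext t
    obtain ⟨r, s, rfl⟩ := IsLocalization.exists_mk'_eq Q.primeCompl t
    rw [IsLocalization.AtPrime.mk'_mem_maximal_iff T Q, Submodule.mem_colon_singleton,
      Submodule.mem_bot]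
    change _ ↔ Ideal.Quotient.mk (I.map (algebraMap R T)) (_ * _) = 0
    rw [Ideal.Quotient.eq_zero_iff_mem, mul_comm, IsLocalization.mul_mk'_eq_mk'_of_mul,
      IsLocalization.mk'_mem_iff, IsLocalization.algebraMap_mem_map_algebraMap_iff Q.primeCompl]
    constructor
    · intro hr
      exact ⟨1, Submonoid.one_mem _, by rw [one_mul, mul_comm]; exact (hy r).1 hr⟩
    · rintro ⟨u, hu, h⟩
      have : u * r ∈ Q := (hy _).2 (by rwa [mul_assoc, mul_comm r])
      exact (Ideal.IsPrime.mem_or_mem inferInstance this).resolve_left hu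
  have h2 := h.height_le_of_isAssociatedPrime h1
  rwa [← IsLocalization.height_under Q.primeCompl,
    IsLocalization.AtPrime.under_maximalIdeal T Q] at h2

end AssociatedPrime

section DeterminantalIdeal
open MvPolynomial

/-- An ideal behaving locally like a determinantal ideal of the generic codimension `c`, which
moreover is a smooth complete intersection at all primes of height at most `c + 1`. -/
structure IsGenericDeterminantal {n : ℕ} (I : Ideal (MvPolynomial (Fin n) ℂ)) (c : ℕ) : Prop where
  le_height : ∀ P : Ideal (MvPolynomial (Fin n) ℂ), P.IsPrime → I ≤ P → (c : ℕ∞) ≤ P.height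
  codimDepth : ∀ (P : Ideal (MvPolynomial (Fin n) ℂ)) [P.IsPrime], I ≤ P →
    CodimDepth (Localization.AtPrime P) c
      (Localization.AtPrime P ⧸ I.map (algebraMap _ (Localization.AtPrime P)))
  exists_independentDifferentials : ∀ P : Ideal (MvPolynomial (Fin n) ℂ), P.IsPrime → I ≤ P →
    P.height ≤ c + 1 → ∃ G : Fin c → MvPolynomial (Fin n) ℂ, (∀ t, G t ∈ I) ∧
      IndependentDifferentials P G

namespace IsGenericDeterminantal
variable {n c : ℕ} {I : Ideal (MvPolynomial (Fin n) ℂ)}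

theorem isRadical (h : IsGenericDeterminantal I c) : I.IsRadical := by
  intro x hx
  by_contra hxI
  obtain ⟨r, P, hP, hr, hrP⟩ := Ideal.exists_isPrime_mem_iff_mul_mem hxI
  have hIP : I ≤ P := fun z hz => (hrP z).2 (I.mul_mem_right _ hz)
  have hht : P.height ≤ c := CodimDepth.height_le_of_forall_mem_iff hrP (h.codimDepth P hIP)
  obtain ⟨G, hG, hGP⟩ := h.exists_independentDifferentials P hP hIP
    (hht.trans le_self_add)
  have hxP : r * x ∈ P := P.mul_mem_left _ (hP.radical_le_iff.2 hIP hx)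
  obtain ⟨s, hs, hsG⟩ := hGP.mem_span_of_height_le (fun t => hIP (hG t))
    (by rwa [Fintype.card_fin]) hxP
  refine hs ((hrP s).2 (Ideal.span_le.2 ?_ hsG))
  rintro _ ⟨t, rfl⟩
  exact hG t

theorem height_eq_of_mem_minimalPrimes (h : IsGenericDeterminantal I c)
    {P : Ideal (MvPolynomial (Fin n) ℂ)} (hP : P ∈ I.minimalPrimes) : P.height = c := by
  have hPp : P.IsPrime := hP.1.1
  refine le_antisymm ?_ (h.le_height P hPp hP.1.2)
  have h1 : P ∈ associatedPrimes _ (MvPolynomial (Fin n) ℂ ⧸ I) :=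
    Module.associatedPrimes.minimalPrimes_annihilator_subset_associatedPrimes _ _
      (by rwa [Ideal.annihilator_quotient])
  obtain ⟨-, y, hy⟩ := isAssociatedPrime_iff.1 h1
  obtain ⟨r, rfl⟩ := Ideal.Quotient.mk_surjective y
  refine CodimDepth.height_le_of_forall_mem_iff (y := r) (fun x => ?_)
    (h.codimDepth P hP.1.2)
  rw [hy, Submodule.mem_colon_singleton, Submodule.mem_bot, ← Ideal.Quotient.eq_zero_iff_mem,
    map_mul]
  rfl

theorem isIntegrallyClosed_quotient (h : IsGenericDeterminantal I c) :
    IsIntegrallyClosed (MvPolynomial (Fin n) ℂ ⧸ I) := by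
  set R := MvPolynomial (Fin n) ℂ
  set K := FractionRing (R ⧸ I)
  rw [isIntegrallyClosed_iff K]
  intro z hz
  obtain ⟨b, ⟨s, hs⟩, rfl⟩ := IsLocalization.exists_mk'_eq (nonZeroDivisors (R ⧸ I)) z
  obtain ⟨b, rfl⟩ := Ideal.Quotient.mk_surjective b
  obtain ⟨s, rfl⟩ := Ideal.Quotient.mk_surjective s
  have hsI : ∀ t, s * t ∈ I → t ∈ I := fun t ht => by
    rw [← Ideal.Quotient.eq_zero_iff_mem, map_mul] at ht
    exact Ideal.Quotient.eq_zero_iff_mem.1 ((mem_nonZeroDivisors_iff.1 hs).1 _ ht)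
  by_cases hb : b ∈ I ⊔ Ideal.span {s}
  · obtain ⟨u, hu, v, hv, rfl⟩ := Submodule.mem_sup.1 hb
    obtain ⟨t, rfl⟩ := Ideal.mem_span_singleton'.1 hv
    refine ⟨Ideal.Quotient.mk I t, ?_⟩
    rw [eq_comm, IsLocalization.mk'_eq_iff_eq_mul, ← map_mul]
    congr 1
    rw [map_add, Ideal.Quotient.eq_zero_iff_mem.2 hu, zero_add, map_mul]
  exfalso
  obtain ⟨r, P, hP, -, hrP⟩ := Ideal.exists_isPrime_mem_iff_mul_mem hb
  set y := r * b with hy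
  have hP' : ∀ x, x ∈ P ↔ ∃ w, x * y - s * w ∈ I := by
    intro x
    rw [hrP, Submodule.mem_sup]
    constructor
    · rintro ⟨u, hu, v, hv, huv⟩
      obtain ⟨t, rfl⟩ := Ideal.mem_span_singleton'.1 hv
      exact ⟨t, by rwa [← huv, mul_comm t, add_sub_cancel_right]⟩
    · rintro ⟨w, hw⟩
      exact ⟨_, hw, s * w, Ideal.mem_span_singleton'.2 ⟨w, mul_comm _ _⟩, sub_add_cancel _ _⟩
  have hIP : I ≤ P := fun x hx => (hrP x).2 (Ideal.mem_sup_left (I.mul_mem_right _ hx))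
  have hsP : s ∈ P := (hP' s).2 ⟨y, by rw [sub_self]; exact I.zero_mem⟩
  have hht : P.height ≤ (c + 1 : ℕ) := by
    refine CodimDepth.height_le_of_forall_mem_iff hrP ?_
    rw [Ideal.map_sup, Ideal.map_span, Set.image_singleton]
    refine (h.codimDepth P hIP).quotient_sup_span_singleton fun t ht => ?_
    obtain ⟨t, u, rfl⟩ := IsLocalization.exists_mk'_eq P.primeCompl t
    rw [IsLocalization.mul_mk'_eq_mk'_of_mul, IsLocalization.mk'_mem_iff,
      IsLocalization.algebraMap_mem_map_algebraMap_iff P.primeCompl] at ht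
    rw [IsLocalization.mk'_mem_iff,
      IsLocalization.algebraMap_mem_map_algebraMap_iff P.primeCompl]
    obtain ⟨m, hm, hmt⟩ := ht
    exact ⟨m, hm, hsI _ (by rwa [mul_left_comm])⟩
  obtain ⟨G, hG, hGP⟩ := h.exists_independentDifferentials P hP hIP (by exact_mod_cast hht)
  obtain ⟨π, hπP, hπ⟩ := hGP.exists_mem_span_of_height_le_succ (fun t => hIP (hG t))
    (by rw [Fintype.card_fin]; exact_mod_cast hht)
  have hGI : Ideal.span (Set.range G) ≤ I := by
    rw [Ideal.span_le]
    rintro _ ⟨t, rfl⟩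
    exact hG t
  have hπ' : ∀ x ∈ P, ∃ u ∉ P, ∃ v, u * x - π * v ∈ I := by
    intro x hx
    obtain ⟨u, hu, hux⟩ := hπ x hx
    obtain ⟨g, hg, w, hw, hgw⟩ := Submodule.mem_sup.1 hux
    obtain ⟨v, rfl⟩ := Ideal.mem_span_singleton'.1 hw
    exact ⟨u, hu, v, by rw [← hgw, mul_comm v, add_sub_cancel_right]; exact hGI hg⟩
  obtain ⟨w, hw⟩ := (hP' π).1 hπP
  have hwP : w ∈ P := by
    have hz' : IsIntegral (R ⧸ I) (IsLocalization.mk' K (Ideal.Quotient.mk I y) ⟨_, hs⟩) := by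
      have := (isIntegral_algebraMap (R := R ⧸ I) (A := K) (x := Ideal.Quotient.mk I r)).mul hz
      rwa [IsLocalization.mul_mk'_eq_mk'_of_mul, ← map_mul] at this
    obtain ⟨f, hf, hfz⟩ := hz'
    have h1 := Polynomial.scaleRoots_eval₂_eq_zero _ (s := Ideal.Quotient.mk I π) hfz
    have h2 : algebraMap (R ⧸ I) K (Ideal.Quotient.mk I π) *
        IsLocalization.mk' K (Ideal.Quotient.mk I y) ⟨_, hs⟩ =
        algebraMap (R ⧸ I) K (Ideal.Quotient.mk I w) := by
      rw [IsLocalization.mul_mk'_eq_mk'_of_mul, IsLocalization.mk'_eq_iff_eq_mul, ← map_mul]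
      rw [← map_mul, ← map_mul, mul_comm w]
      exact congrArg _ (Ideal.Quotient.eq.2 hw)
    rw [h2, Polynomial.eval₂_at_apply, map_eq_zero_iff _ (IsFractionRing.injective _ _)] at h1
    have h3 := congrArg (Ideal.Quotient.factor hIP) h1
    rw [map_zero, ← Polynomial.eval₂_at_apply, ← Polynomial.eval_map, Polynomial.map_scaleRoots,
      Ideal.Quotient.factor_mk, Ideal.Quotient.factor_mk, Ideal.Quotient.eq_zero_iff_mem.2 hπP,
      Polynomial.scaleRoots_zero, (hf.map _).leadingCoeff, one_smul, Polynomial.eval_pow,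
      Polynomial.eval_X] at h3
    · exact Ideal.Quotient.eq_zero_iff_mem.1 (eq_zero_of_pow_eq_zero h3)
    · rw [hf.leadingCoeff, map_one]
      have : Nontrivial (R ⧸ P) := Ideal.Quotient.nontrivial_iff.2 hP.ne_top
      exact one_ne_zero
  obtain ⟨u, hu, v, huv⟩ := hπ' w hwP
  obtain ⟨u', hu', v', huv'⟩ := hπ' s hsP
  have h1 : s * (u' * (u * y - s * v)) ∈ I := by
    have h2 : π * (u * y - s * v) ∈ I := by
      have := I.add_mem (I.mul_mem_left u hw) (I.mul_mem_left s huv)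
      convert this using 1
      ring
    have := I.add_mem (I.mul_mem_left v' h2) (I.mul_mem_left (u * y - s * v) huv')
    convert this using 1
    ring
  have h2 : u' * u ∈ P := by
    refine (hP' _).2 ⟨u' * v, ?_⟩
    convert hsI _ h1 using 1
    ring
  exact (hP.mem_or_mem h2).elim hu' hu

end IsGenericDeterminantal
end DeterminantalIdeal

section PolarDeterminantal
open MvPolynomial

theorem isGenericDeterminantal_polarMinorIdeal {n p d i m : ℕ}
    {F : Fin p → MvPolynomial (Fin n) ℂ} {ε : ℂ} {a : Fin d × Fin n → ℂ}
    (hF : ∀ P : Ideal (MvPolynomial (Fin n) ℂ), P.IsPrime → (∀ t, F t ∈ P) →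
      ∃ E : Fin p → Fin n, (Matrix.of fun t u => pderiv (E u) (F t)).det ∉ P)
    (hgen : PolarGeneric F ε a) (hd : p + d = n) (hm : m + i = d + 1) (hi : 1 ≤ i) :
    IsGenericDeterminantal (polarMinorIdeal F ε a m Set.univ) (p + i) := by
  classical
  have hmd : m ≤ d := by omega
  have key : ∀ P : Ideal (MvPolynomial (Fin n) ℂ), P.IsPrime →
      polarMinorIdeal F ε a m Set.univ ≤ P → ∃ q, q < p + m ∧
        ∃ (ρ : Fin q → Fin p ⊕ Fin d) (γ : Fin q → Fin n),
          IsMaximalMinor P F ε a m Set.univ ρ γ ∧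
          ((p + (p + m - q) * (n - q) : ℕ) : ℕ∞) ≤ P.height := by
    intro P hP hIP
    have hFP : ∀ t, F t ∈ P := fun t => hIP (mem_polarMinorIdeal_of_mem m _ t)
    obtain ⟨E, hE⟩ := hF P hP hFP
    obtain ⟨q, hq, ρ, γ, h⟩ := exists_isMaximalMinor (E := E) (fun _ => Set.mem_univ _) hE hIP
    exact ⟨q, hq, ρ, γ, h, h.add_mul_le_height hmd hgen hFP (by simp [Set.ncard_univ])⟩
  refine ⟨fun P hP hIP => ?_, fun P hP hIP => ?_, fun P hP hIP hht => ?_⟩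
  · obtain ⟨q, hq, ρ, γ, h, hle⟩ := key P hP hIP
    refine le_trans ?_ hle
    have : i ≤ (p + m - q) * (n - q) := le_trans (by omega) (Nat.le_mul_of_pos_left _ (by omega))
    exact_mod_cast Nat.add_le_add_left this p
  · obtain ⟨E, hE⟩ := hF P hP fun t => hIP (mem_polarMinorIdeal_of_mem m _ t)
    have := codimDepth_quotient_map_polarMinorIdeal hd hgen hE hmd
    rwa [show p + n + 1 - (p + m) = p + i by omega] at this
  · obtain ⟨q, hq, ρ, γ, h, hle⟩ := key P hP hIP
    have hpq := h.le_card
    have hq' : q + 1 = p + m := by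
      by_contra hne
      have h1 : 2 * (i + 1) ≤ (p + m - q) * (n - q) := Nat.mul_le_mul (by omega) (by omega)
      have h2 : p + (p + m - q) * (n - q) ≤ p + i + 1 := by exact_mod_cast hle.trans hht
      omega
    have hrow := h.card_rows hmd
    obtain ⟨k, hk⟩ := Finset.card_pos.1 (lt_of_lt_of_le (by omega) hrow)
    rw [Finset.mem_filter] at hk
    set B : Finset (Fin d × Fin n) := {k} ×ˢ (Finset.univ \ Finset.univ.image γ) with hB
    have hBc : i ≤ B.card := by
      have h1 : (Finset.univ.image γ).card = q := by
        rw [Finset.card_image_of_injective _ h.injective_right, Finset.card_univ, Fintype.card_fin]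
      rw [hB, Finset.card_product, Finset.card_singleton, Finset.card_sdiff_of_subset
        (Finset.subset_univ _), h1, Finset.card_univ, Fintype.card_fin]
      omega
    obtain ⟨-, hind⟩ := h.independentDifferentials hgen
      (fun t => hIP (mem_polarMinorIdeal_of_mem m _ t)) (B := B) (fun x hx => by
        rw [hB, Finset.mem_product, Finset.mem_singleton, Finset.mem_sdiff] at hx
        obtain ⟨h1, -, h2⟩ := hx
        rw [h1]
        exact ⟨hk.2.1, hk.2.2, Set.mem_univ _, fun v hv =>
          h2 (Finset.mem_image.2 ⟨v, Finset.mem_univ _, hv⟩)⟩)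
    obtain ⟨e⟩ : Nonempty (Fin (p + i) ↪ Fin p ⊕ B) :=
      Function.Embedding.nonempty_of_card_le (by simpa using hBc)
    refine ⟨_, fun t => ?_, hind.comp e.injective⟩
    rw [Function.comp_apply]
    cases e t with
    | inl t => exact mem_polarMinorIdeal_of_mem m _ t
    | inr x =>
      have hx := Finset.mem_singleton.1 (Finset.mem_product.1 x.2).1
      refine det_mem_polarMinorIdeal hq' ?_ (fun u => ?_) fun _ => Set.mem_univ _
      · rw [Fin.cons_injective_iff, hx]
        exact ⟨fun ⟨u, hu⟩ => hk.2.2 u hu, h.inj⟩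
      · refine Fin.cases ?_ (fun u => ?_) u
        · intro k' hk'
          rw [Fin.cons_zero, Sum.inr.injEq, hx] at hk'
          exact hk' ▸ hk.2.1
        · rw [Fin.cons_succ]
          exact h.rowLt u

end PolarDeterminantal

section LocalDimension

theorem ringKrullDim_quotient_le_of_height_le {T : Type} [CommRing T] [IsNoetherianRing T]
    {I : Ideal T} {c j : ℕ} (hI : ∀ P : Ideal T, P.IsPrime → I ≤ P → (c : ℕ∞) ≤ P.height)
    (hT : ∀ P : Ideal T, P.IsPrime → P.height ≤ (c + j : ℕ)) : ringKrullDim (T ⧸ I) ≤ j := by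
  rw [ringKrullDim_quotient]
  have hfin : ∀ P : PrimeSpectrum T, ((P.asIdeal.height.toNat : ℕ) : ℕ∞) = P.asIdeal.height :=
    fun P => ENat.natCast_toNat ((hT _ P.2).trans_lt (ENat.natCast_lt_top _)).ne
  let f : PrimeSpectrum.zeroLocus (I : Set T) → ℕ := fun P => P.1.asIdeal.height.toNat
  have hf : StrictMono f := by
    intro P Q hPQ
    have h1 := Ideal.height_add_one_le_of_lt_of_isPrime (I := P.1.asIdeal) (J := Q.1.asIdeal) hPQ
    rw [← hfin P.1, ← hfin Q.1] at h1
    exact_mod_cast h1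
  refine iSup_le fun l => ?_
  have h1 := (l.map f hf).head_add_length_le_nat
  have h2 : c ≤ (l.map f hf).head := by
    have := hI l.head.1.asIdeal l.head.1.2 l.head.2
    rw [← hfin] at this
    exact_mod_cast this
  have h3 : (l.map f hf).last ≤ c + j := by
    have := hT l.last.1.asIdeal l.last.1.2
    rw [← hfin] at this
    exact_mod_cast this
  have h4 : (l.map f hf).length = l.length := rfl
  have h5 : l.length ≤ j := by omega
  exact_mod_cast h5

theorem ringKrullDim_quotient_sup_span_singleton_add_one_le {T : Type} [CommRing T] {I : Ideal T}
    {x : T} (hx : ∀ y, x * y ∈ I → y ∈ I) :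
    ringKrullDim (T ⧸ I ⊔ Ideal.span {x}) + 1 ≤ ringKrullDim (T ⧸ I) := by
  have h1 : Ideal.Quotient.mk I x ∈ nonZeroDivisors (T ⧸ I) := by
    rw [mem_nonZeroDivisors_iff_left]
    intro y hy
    obtain ⟨y, rfl⟩ := Ideal.Quotient.mk_surjective y
    rw [← map_mul, Ideal.Quotient.eq_zero_iff_mem] at hy
    exact Ideal.Quotient.eq_zero_iff_mem.2 (hx y hy)
  have h2 := DoubleQuot.quotQuotEquivQuotSup I (Ideal.span {x})
  rw [Ideal.map_span, Set.image_singleton] at h2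
  rw [← ringKrullDim_eq_of_ringEquiv h2]
  exact ringKrullDim_quotient_succ_le_of_nonZeroDivisor h1

/-- The list `rs` is a weakly regular sequence modulo the ideal `I`. -/
def IsRegularModulo {T : Type} [CommRing T] (I : Ideal T) (rs : List T) : Prop :=
  ∀ j, j < rs.length → ∀ b : T, rs.getD j 0 * b ∈ I ⊔ Ideal.span {x | x ∈ rs.take j} →
    b ∈ I ⊔ Ideal.span {x | x ∈ rs.take j}

lemma IsRegularModulo.cons {T : Type} [CommRing T] {I : Ideal T} {x : T} {rs : List T}
    (hx : ∀ y, x * y ∈ I → y ∈ I) (h : IsRegularModulo (I ⊔ Ideal.span {x}) rs) :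
    IsRegularModulo I (x :: rs) := by
  intro j hj b hb
  cases j with
  | zero =>
    simp only [List.take_zero, List.not_mem_nil, Set.ofPred_false, Ideal.span_empty, sup_bot_eq,
      List.getD_cons_zero] at hb ⊢
    exact hx b hb
  | succ j =>
    have h1 : {y | y ∈ (x :: rs).take (j + 1)} = {x} ∪ {y | y ∈ rs.take j} := by
      ext y
      simp
    rw [h1, Ideal.span_union, ← sup_assoc] at hb ⊢
    exact h j (by simpa using hj) b (by simpa using hb)

theorem CodimDepth.exists_isRegularModulo {T : Type} [CommRing T] [IsNoetherianRing T]
    [IsLocalRing T] (j : ℕ) : ∀ {c : ℕ} {I : Ideal T}, I ≠ ⊤ → CodimDepth T c (T ⧸ I) →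
      ((c + j : ℕ) : ℕ∞) ≤ (IsLocalRing.maximalIdeal T).height →
      ∃ rs : List T, rs.length = j ∧ (∀ r ∈ rs, r ∈ IsLocalRing.maximalIdeal T) ∧
        IsRegularModulo I rs ∧ (j : WithBot ℕ∞) ≤ ringKrullDim (T ⧸ I) := by
  induction j with
  | zero =>
    intro c I hI _ _
    have : Nontrivial (T ⧸ I) := Ideal.Quotient.nontrivial_iff.2 hI
    exact ⟨[], rfl, by simp, fun j hj => absurd hj (by simp), by
      exact_mod_cast ringKrullDim_nonneg_of_nontrivial⟩
  | succ j ih =>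
    intro c I hI h hht
    obtain ⟨x, hxm, hx⟩ : ∃ x ∈ IsLocalRing.maximalIdeal T,
        ∀ Q ∈ associatedPrimes T (T ⧸ I), x ∉ Q := by
      by_contra! hcon
      have hfin := associatedPrimes.finite T (T ⧸ I)
      obtain ⟨Q, hQ, hle⟩ := (Ideal.subset_union_prime (s := hfin.toFinset) (f := id) ⊥ ⊥
        (fun Q hQ _ _ => (hfin.mem_toFinset.1 hQ).isPrime)).1 (fun x hx => by
          obtain ⟨Q, hQ, hxQ⟩ := hcon x hx
          exact Set.mem_iUnion₂.2 ⟨Q, by simpa using hQ, hxQ⟩)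
      have hQ' := hfin.mem_toFinset.1 hQ
      have h1 := (Ideal.height_mono hle).trans (h.height_le_of_isAssociatedPrime hQ')
      have h2 : c + (j + 1) ≤ c := by exact_mod_cast hht.trans h1
      omega
    have hreg : ∀ y, x * y ∈ I → y ∈ I := fun y => mem_of_mul_mem_of_notMem_associatedPrimes hx
    have hI' : I ⊔ Ideal.span {x} ≠ ⊤ := by
      refine ne_top_of_le_ne_top (IsLocalRing.maximalIdeal.isMaximal T).ne_top
        (sup_le (IsLocalRing.le_maximalIdeal hI) ?_)
      rwa [Ideal.span_singleton_le_iff_mem]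
    obtain ⟨rs, hlen, hmem, hrs, hdim⟩ := ih hI' (h.quotient_sup_span_singleton hreg)
      (by rwa [add_assoc, add_comm 1])
    refine ⟨x :: rs, by simp [hlen], ?_, hrs.cons hreg, ?_⟩
    · simpa using ⟨hxm, hmem⟩
    · refine le_trans ?_ (ringKrullDim_quotient_sup_span_singleton_add_one_le hreg)
      push_cast
      exact add_le_add_left hdim 1

end LocalDimension

section CohenMacaulayQuotient
open MvPolynomial

theorem isCMLocalRing_of_isRegularModulo_ker {T A : Type} [CommRing T] [CommRing A] [IsLocalRing T]
    [IsLocalRing A] {φ : T →+* A} (hφ : Function.Surjective φ) {rs : List T}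
    (hmem : ∀ r ∈ rs, r ∈ IsLocalRing.maximalIdeal T) (hrs : IsRegularModulo (RingHom.ker φ) rs)
    (hdim : (rs.length : WithBot ℕ∞) = ringKrullDim A) : IsCMLocalRing A := by
  have hloc : IsLocalHom φ := IsLocalHom.of_surjective φ hφ
  have hunit : ∀ r ∈ rs.map φ, r ∈ IsLocalRing.maximalIdeal A := by
    intro r hr
    obtain ⟨t, ht, rfl⟩ := List.mem_map.1 hr
    rw [IsLocalRing.mem_maximalIdeal, mem_nonunits_iff]
    exact fun hu => (IsLocalRing.mem_maximalIdeal _).1 (hmem t ht) (isUnit_of_map_unit φ t hu)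
  have hspan : ∀ (l : List T) (b : T), φ b ∈ Ideal.span {x | x ∈ l.map φ} ↔
      b ∈ RingHom.ker φ ⊔ Ideal.span {x | x ∈ l} := by
    intro l b
    have h1 : {x | x ∈ l.map φ} = φ '' {x | x ∈ l} := by
      ext y
      simp
    rw [h1, ← Ideal.map_span, ← Ideal.mem_comap, Ideal.comap_map_of_surjective' φ hφ, sup_comm]
  refine ⟨rs.map φ, fun r hr => (IsLocalRing.mem_maximalIdeal _).1 (hunit r hr), ⟨?_, ?_⟩,
    (congrArg Nat.cast (List.length_map φ)).trans hdim⟩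
  · exact ne_top_of_le_ne_top (IsLocalRing.maximalIdeal.isMaximal A).ne_top (Ideal.span_le.2 hunit)
  · intro j hj b hb
    obtain ⟨b, rfl⟩ := hφ b
    rw [List.length_map] at hj
    rw [← List.map_take] at hb ⊢
    rw [hspan]
    refine hrs j hj b ((hspan _ _).1 ?_)
    rw [map_mul]
    simpa [List.getD_eq_getElem?_getD, List.getElem?_eq_getElem hj] using hb

theorem ker_localRingHom_quotient {R : Type} [CommRing R] (I : Ideal R) (P : Ideal (R ⧸ I))
    [P.IsPrime] :
    RingHom.ker (Localization.localRingHom (P.comap (Ideal.Quotient.mk I)) P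
      (Ideal.Quotient.mk I) rfl) =
    I.map (algebraMap R (Localization.AtPrime (P.comap (Ideal.Quotient.mk I)))) := by
  refine le_antisymm (fun z hz => ?_) ?_
  · obtain ⟨r, s, rfl⟩ := IsLocalization.exists_mk'_eq (P.comap (Ideal.Quotient.mk I)).primeCompl z
    rw [RingHom.mem_ker, Localization.localRingHom_mk', IsLocalization.mk'_eq_zero_iff] at hz
    obtain ⟨⟨m, hm⟩, hmr⟩ := hz
    obtain ⟨m, rfl⟩ := Ideal.Quotient.mk_surjective m
    rw [IsLocalization.mk'_mem_iff, IsLocalization.algebraMap_mem_map_algebraMap_iff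
      (P.comap (Ideal.Quotient.mk I)).primeCompl]
    refine ⟨m, hm, ?_⟩
    rwa [← Ideal.Quotient.eq_zero_iff_mem, map_mul]
  · rw [Ideal.map_le_iff_le_comap]
    intro x hx
    rw [Ideal.mem_comap, RingHom.mem_ker, Localization.localRingHom_to_map,
      Ideal.Quotient.eq_zero_iff_mem.2 hx, map_zero]

theorem MvPolynomial.height_eq_of_isMaximal {n : ℕ} {M : Ideal (MvPolynomial (Fin n) ℂ)}
    (hM : M.IsMaximal) : M.height = n := by
  refine le_antisymm ?_ ?_
  · have h1 := Ideal.height_le_ringKrullDim_of_ne_top hM.ne_top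
    rw [MvPolynomial.ringKrullDim_of_isNoetherianRing, ringKrullDim_eq_zero_of_field, zero_add,
      Nat.card_eq_fintype_card, Fintype.card_fin] at h1
    exact_mod_cast h1
  · obtain ⟨x, rfl⟩ := MvPolynomial.isMaximal_iff_eq_vanishingIdeal_singleton.1 hM
    have h1 : IndependentDifferentials (vanishingIdeal ℂ {x})
        (fun l => (X l - C (x l) : MvPolynomial (Fin n) ℂ)) := by
      intro r hr t
      have := hr t
      simpa [pderiv_X, Pi.single_apply] using this
    have := hM.isPrime
    have h2 := h1.card_le_height fun l => by
      rw [mem_vanishingIdeal_singleton_iff]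
      simp
    rwa [Fintype.card_fin] at h2

theorem MvPolynomial.height_le {n : ℕ} {P : Ideal (MvPolynomial (Fin n) ℂ)} (hP : P ≠ ⊤) :
    P.height ≤ n := by
  obtain ⟨M, hM, hPM⟩ := Ideal.exists_le_maximal P hP
  exact (Ideal.height_mono hPM).trans (MvPolynomial.height_eq_of_isMaximal hM).le

namespace IsGenericDeterminantal
variable {n c : ℕ} {I : Ideal (MvPolynomial (Fin n) ℂ)}

theorem isCMRing_quotient (h : IsGenericDeterminantal I c) :
    IsCMRing (MvPolynomial (Fin n) ℂ ⧸ I) := by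
  intro P hP hPm
  set P' := P.comap (Ideal.Quotient.mk I) with hP'
  have hP'm : P'.IsMaximal := Ideal.comap_isMaximal_of_surjective _ Ideal.Quotient.mk_surjective
  have hIP' : I ≤ P' := fun x hx => by
    rw [hP', Ideal.mem_comap, Ideal.Quotient.eq_zero_iff_mem.2 hx]
    exact P.zero_mem
  have hht := MvPolynomial.height_eq_of_isMaximal hP'm
  have hcn : c ≤ n := by exact_mod_cast hht ▸ h.le_height P' hP'm.isPrime hIP'
  set T := Localization.AtPrime P' with hT
  have hhtT : ∀ Q : Ideal T, (Q.under _).height = Q.height :=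
    IsLocalization.height_under P'.primeCompl
  have hmax : (IsLocalRing.maximalIdeal T).height = n := by
    rw [← hhtT, IsLocalization.AtPrime.under_maximalIdeal T P', hht]
  have hφ := RingHom.surjective_localRingHom_of_surjective _
    (Ideal.Quotient.mk_surjective (I := I)) P
  have hker := ker_localRingHom_quotient I P
  have hne : I.map (algebraMap _ T) ≠ ⊤ := by
    rw [← hker]
    exact RingHom.ker_ne_top _
  obtain ⟨rs, hlen, hmem, hrs, hdim⟩ := (h.codimDepth P' hIP').exists_isRegularModulo (n - c) hne
    (by rw [hmax, Nat.add_sub_cancel' hcn])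
  refine isCMLocalRing_of_isRegularModulo_ker hφ hmem (hker ▸ hrs) ?_
  rw [← ringKrullDim_eq_of_ringEquiv (RingHom.quotientKerEquivOfSurjective hφ), hker, hlen]
  refine le_antisymm hdim (ringKrullDim_quotient_le_of_height_le (c := c) (fun Q hQ hIQ => ?_)
    fun Q hQ => ?_)
  · rw [← hhtT]
    exact h.le_height _ inferInstance (Ideal.map_le_iff_le_comap.1 hIQ)
  · rw [Nat.add_sub_cancel' hcn, ← hhtT]
    exact MvPolynomial.height_le (Ideal.IsPrime.ne_top inferInstance)

theorem ringKrullDim_quotient_eq (h : IsGenericDeterminantal I c)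
    {P : Ideal (MvPolynomial (Fin n) ℂ)} (hP : P ∈ I.minimalPrimes) :
    ringKrullDim (MvPolynomial (Fin n) ℂ ⧸ P) = (n - c : ℕ) := by
  have hPp : P.IsPrime := hP.1.1
  have hht := h.height_eq_of_mem_minimalPrimes hP
  have hcn : c ≤ n := by exact_mod_cast hht ▸ MvPolynomial.height_le hPp.ne_top
  refine le_antisymm (ringKrullDim_quotient_le_of_height_le (c := c)
    (fun Q hQ hPQ => h.le_height Q hQ (hP.1.2.trans hPQ)) fun Q hQ => by
      rw [Nat.add_sub_cancel' hcn]
      exact MvPolynomial.height_le hQ.ne_top) ?_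
  obtain ⟨G, hG, hGP⟩ := h.exists_independentDifferentials P hPp hP.1.2 (hht.le.trans le_self_add)
  have hloc : ∀ x ∈ P, ∃ s ∉ P, s * x ∈ Ideal.span (Set.range G) := fun x hx =>
    hGP.mem_span_of_height_le (fun t => hP.1.2 (hG t)) (by rw [Fintype.card_fin, hht]) hx
  obtain ⟨s, hs, hsP⟩ : ∃ s ∉ P, ∀ x ∈ P, s * x ∈ Ideal.span (Set.range G) := by
    obtain ⟨A, hA⟩ := (inferInstance : IsNoetherian _ (MvPolynomial (Fin n) ℂ)).noetherian P
    choose! f hf hfG using hloc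
    have hAP : ∀ x ∈ A, x ∈ P := fun x hx => hA ▸ Submodule.subset_span hx
    refine ⟨∏ x ∈ A, f x, fun hmem => ?_, fun x hx => ?_⟩
    · obtain ⟨x, hx, hxP⟩ := (hPp.prod_mem_iff).1 hmem
      exact hf x (hAP x hx) hxP
    · rw [← hA] at hx
      induction hx using Submodule.span_induction with
      | mem x hx =>
        rw [← Finset.prod_erase_mul A f hx, mul_assoc]
        exact Ideal.mul_mem_left _ _ (hfG x (hAP x hx))
      | zero => rw [mul_zero]; exact Ideal.zero_mem _
      | add x y _ _ hx hy => rw [mul_add]; exact Ideal.add_mem _ hx hy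
      | smul r x _ hx => rw [smul_eq_mul, mul_left_comm]; exact Ideal.mul_mem_left _ _ hx
  obtain ⟨M, hM, hPM, hsM⟩ : ∃ M : Ideal (MvPolynomial (Fin n) ℂ), M.IsMaximal ∧ P ≤ M ∧ s ∉ M := by
    by_contra! hcon
    refine hs ?_
    rw [← (isJacobsonRing_iff_prime_eq.1 inferInstance) P hPp]
    exact Submodule.mem_sInf.2 fun M hM => hcon M hM.2 hM.1
  set T := Localization.AtPrime M with hT
  have hhtT : (IsLocalRing.maximalIdeal T).height = n := by
    rw [← IsLocalization.height_under M.primeCompl, IsLocalization.AtPrime.under_maximalIdeal T M,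
      MvPolynomial.height_eq_of_isMaximal hM]
  have hPT : P.map (algebraMap _ T) = (Ideal.span (Set.range G)).map (algebraMap _ T) := by
    refine le_antisymm (Ideal.map_le_iff_le_comap.2 fun x hx => ?_) (Ideal.map_mono ?_)
    · rw [Ideal.mem_comap, IsLocalization.algebraMap_mem_map_algebraMap_iff M.primeCompl]
      exact ⟨s, hsM, hsP x hx⟩
    · rw [Ideal.span_le]
      rintro _ ⟨t, rfl⟩
      exact hP.1.2 (hG t)
  have hle : P.map (algebraMap _ T) ≤ IsLocalRing.maximalIdeal T := by
    rw [Ideal.map_le_iff_le_comap]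
    exact hPM.trans (IsLocalization.AtPrime.under_maximalIdeal T M).ge
  have h1 := height_le_ringKrullDim_quotient_add_spanFinrank hle
  have h2 : Submodule.spanFinrank (P.map (algebraMap _ T)) ≤ c := by
    rw [hPT, Ideal.map_span]
    refine (Submodule.spanFinrank_span_le_ncard_of_finite (Set.toFinite _)).trans ?_
    refine (Set.ncard_image_le (Set.toFinite _)).trans ?_
    rw [← Set.image_univ]
    refine (Set.ncard_image_le (Set.toFinite _)).trans ?_
    rw [Set.ncard_univ, Nat.card_eq_fintype_card, Fintype.card_fin]
  have h3 : ringKrullDim (T ⧸ P.map (algebraMap _ T)) ≤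
      ringKrullDim (MvPolynomial (Fin n) ℂ ⧸ P) := by
    rw [ringKrullDim_quotient, ringKrullDim_quotient]
    refine Order.krullDim_le_of_strictMono (fun Q => ⟨Q.1.comap (algebraMap _ T), ?_⟩) ?_
    · exact Ideal.map_le_iff_le_comap.1 Q.2
    · exact fun Q Q' hQ => (IsLocalization.orderEmbedding M.primeCompl T).strictMono
        (a := Q.1.asIdeal) (b := Q'.1.asIdeal) hQ
  rw [hhtT] at h1
  have h4 : ((n : ℕ∞) : WithBot ℕ∞) ≤ ringKrullDim (MvPolynomial (Fin n) ℂ ⧸ P) + (c : ℕ) :=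
    h1.trans (add_le_add h3 (by exact_mod_cast h2))
  revert h4
  generalize ringKrullDim (MvPolynomial (Fin n) ℂ ⧸ P) = δ
  intro h4
  cases δ with
  | bot => simp at h4
  | coe δ =>
    cases δ with
    | top => simp
    | coe δ =>
      have h5 : n ≤ δ + c := by exact_mod_cast h4
      exact WithBot.coe_le_coe.2 (WithTop.coe_le_coe.2 (by omega))

end IsGenericDeterminantal
end CohenMacaulayQuotient

section PolarLocus
open MvPolynomial

lemma Matrix.linearIndependent_row_comp_of_det_ne_zero {ι : Type} {q n : ℕ}
    {N : Matrix ι (Fin n) ℂ} {ρ : Fin q → ι} {γ : Fin q → Fin n} (h : (N.submatrix ρ γ).det ≠ 0) :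
    LinearIndependent ℂ (N.row ∘ ρ) :=
  LinearIndependent.of_comp (LinearMap.funLeft ℂ ℂ γ)
    (Matrix.linearIndependent_rows_of_det_ne_zero h)

lemma Matrix.exists_det_submatrix_ne_zero_of_rank {ι : Type} [Fintype ι] [DecidableEq ι] {n : ℕ}
    {N : Matrix ι (Fin n) ℂ} (h : Fintype.card ι ≤ N.rank) :
    ∃ e : ι → Fin n, (N.submatrix id e).det ≠ 0 := by
  refine Matrix.exists_det_submatrix_ne_zero N
    (linearIndependent_iff_card_eq_finrank_span.2 (le_antisymm ?_ (finrank_range_le_card _)))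
  rwa [Matrix.rank_eq_finrank_span_row] at h

/-- The generic matrix whose polar varieties are studied, evaluated at a point. -/
noncomputable def polarMatrixAt {n p d : ℕ} (F : Fin p → MvPolynomial (Fin n) ℚ) (ε : ℂ)
    (a : Matrix (Fin d) (Fin n) ℂ) (x : Fin n → ℂ) : Matrix (Fin p ⊕ Fin d) (Fin n) ℂ :=
  Matrix.fromRows (jacC F x) (Matrix.of fun k l => a k l - ε * x l)

variable {n p d m : ℕ} {F : Fin p → MvPolynomial (Fin n) ℚ}

lemma eval_polarMatrix (ε : ℂ) (a : Matrix (Fin d) (Fin n) ℂ) (x : Fin n → ℂ) :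
    (polarMatrix (fun t => map (algebraMap ℚ ℂ) (F t)) ε fun q => a q.1 q.2).map (eval x) =
      polarMatrixAt F ε a x := by
  ext r l
  cases r with
  | inl t =>
    simp only [polarMatrix, polarMatrixAt, Matrix.map_apply, Matrix.of_apply, Sum.elim_inl,
      Matrix.fromRows_apply_inl, jacC, pderiv_map]
    rw [← coe_aeval_eq_eval]
    exact aeval_map_algebraMap ℂ x _
  | inr k => simp [polarMatrix, polarMatrixAt]

lemma eval_det_polarMatrix (ε : ℂ) (a : Matrix (Fin d) (Fin n) ℂ) (x : Fin n → ℂ) {q : ℕ}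
    (ρ : Fin q → Fin p ⊕ Fin d) (γ : Fin q → Fin n) :
    eval x ((polarMatrix (fun t => map (algebraMap ℚ ℂ) (F t)) ε
      fun q => a q.1 q.2).submatrix ρ γ).det = ((polarMatrixAt F ε a x).submatrix ρ γ).det := by
  rw [RingHom.map_det, ← eval_polarMatrix]
  rfl

lemma polarMatrixAt_firstRows (ε : ℂ) (a : Matrix (Fin d) (Fin n) ℂ) (hm : m ≤ d)
    (x : Fin n → ℂ) : polarMatrixAt F ε (firstRows a hm) x =
      (polarMatrixAt F ε a x).submatrix (Sum.map id (Fin.castLE hm)) id := by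
  ext r l
  cases r <;> rfl

lemma aeval_map_eq_zero_iff_mem_zeroSetC {x : Fin n → ℂ} :
    (∀ t, aeval x (map (algebraMap ℚ ℂ) (F t)) = 0) ↔ x ∈ zeroSetC F :=
  forall_congr' fun t => by rw [aeval_map_algebraMap]

theorem exists_det_pderiv_notMem (hsmooth : SregC F = zeroSetC F)
    {P : Ideal (MvPolynomial (Fin n) ℂ)} (hP : P.IsPrime)
    (hFP : ∀ t, map (algebraMap ℚ ℂ) (F t) ∈ P) :
    ∃ E : Fin p → Fin n,
      (Matrix.of fun t u => pderiv (E u) (map (algebraMap ℚ ℂ) (F t))).det ∉ P := by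
  obtain ⟨M, hM, hPM⟩ := Ideal.exists_le_maximal P hP.ne_top
  obtain ⟨x, rfl⟩ := isMaximal_iff_eq_vanishingIdeal_singleton.1 hM
  have hx : x ∈ zeroSetC F := aeval_map_eq_zero_iff_mem_zeroSetC.1 fun t =>
    (mem_vanishingIdeal_singleton_iff x _).1 (hPM (hFP t))
  rw [← hsmooth] at hx
  obtain ⟨E, hE⟩ := Matrix.exists_det_submatrix_ne_zero_of_rank (N := jacC F x)
    (by rw [Fintype.card_fin, hx.2])
  refine ⟨E, fun hmem => hE ?_⟩
  have h1 := (mem_vanishingIdeal_singleton_iff x _).1 (hPM hmem)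
  rw [aeval_eq_eval, RingHom.map_det] at h1
  rw [← h1]
  congr 1
  ext t u
  simp only [Matrix.submatrix_apply, jacC, Matrix.of_apply, RingHom.mapMatrix_apply,
    Matrix.map_apply, pderiv_map, id]
  rw [← coe_aeval_eq_eval]
  exact (aeval_map_algebraMap ℂ x _).symm

theorem zeroLocus_polarMinorIdeal (ε : ℂ) (a : Matrix (Fin d) (Fin n) ℂ) (hm : m ≤ d) {r : ℕ}
    (hr : r + 1 = p + m) :
    zeroLocus ℂ (polarMinorIdeal (fun t => map (algebraMap ℚ ℂ) (F t)) ε (fun q => a q.1 q.2) m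
      Set.univ) = {x | x ∈ zeroSetC F ∧ (polarMatrixAt F ε (firstRows a hm) x).rank ≤ r} := by
  ext x
  rw [polarMinorIdeal, ← Ideal.span_union, zeroLocus_span, Set.mem_ofPred_eq, Set.mem_ofPred_eq,
    ← aeval_map_eq_zero_iff_mem_zeroSetC]
  constructor
  · intro h
    refine ⟨fun t => h _ (Or.inl ⟨t, rfl⟩), ?_⟩
    by_contra! hlt
    obtain ⟨e, he⟩ := Matrix.exists_det_submatrix_ne_zero_of_rank
      (N := polarMatrixAt F ε (firstRows a hm) x) (by simp; omega)
    refine he ?_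
    have h1 := h _ (Or.inr ⟨Sum.map id (Fin.castLE hm) ∘ finSumFinEquiv.symm,
      e ∘ finSumFinEquiv.symm, ?_, ?_, fun _ => Set.mem_univ _, rfl⟩)
    · rw [aeval_eq_eval, eval_det_polarMatrix] at h1
      rw [polarMatrixAt_firstRows, ← Matrix.det_submatrix_equiv_self finSumFinEquiv.symm, ← h1]
      rfl
    · exact (Sum.map_injective.2 ⟨Function.injective_id, Fin.castLE_injective hm⟩).comp
        finSumFinEquiv.symm.injective
    · intro u k hk
      rw [Function.comp_apply] at hk
      generalize finSumFinEquiv.symm u = y at hk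
      cases y with
      | inl t => simp at hk
      | inr k' =>
        rw [Sum.map_inr, Sum.inr.injEq] at hk
        rw [← hk]
        exact k'.2
  · rintro ⟨h1, h2⟩ f (⟨t, rfl⟩ | ⟨ρ, γ, hρ, hlt, -, rfl⟩)
    · exact h1 t
    rw [aeval_eq_eval, eval_det_polarMatrix]
    by_contra hdet
    have hex : ∀ u, ∃ y, Sum.map id (Fin.castLE hm) y = ρ u := by
      intro u
      rcases hu : ρ u with t | k
      · exact ⟨Sum.inl t, rfl⟩
      · exact ⟨Sum.inr ⟨k, hlt u k hu⟩, rfl⟩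
    choose g hg using hex
    have h3 : ((polarMatrixAt F ε (firstRows a hm) x).submatrix g γ).det ≠ 0 := by
      rwa [polarMatrixAt_firstRows, Matrix.submatrix_submatrix, Function.id_comp,
        show Sum.map id (Fin.castLE hm) ∘ g = ρ from funext hg]
    have h4 := finrank_span_eq_card (Matrix.linearIndependent_row_comp_of_det_ne_zero h3)
    have h5 := Submodule.finrank_mono (Submodule.span_mono (R := ℂ)
      (Set.range_comp_subset_range g (polarMatrixAt F ε (firstRows a hm) x).row))
    rw [h4, ← Matrix.rank_eq_finrank_span_row, Fintype.card_fin] at h5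
    omega

lemma zcl_zeroLocus (I : Ideal (MvPolynomial (Fin n) ℂ)) : zcl (zeroLocus ℂ I) = zeroLocus ℂ I :=
  (zeroLocus_vanishingIdeal_galoisConnection (k := ℂ) (K := ℂ) (σ := Fin n)).l_u_l_eq_l I

theorem exists_rank_firstRows (hd : d ≤ n) :
    ∃ f : MvPolynomial (Fin d × Fin n) ℂ, f ≠ 0 ∧ ∀ a : Matrix (Fin d) (Fin n) ℂ,
      eval (fun q => a q.1 q.2) f ≠ 0 → ∀ m, ∀ hm : m ≤ d, (firstRows a hm).rank = m := by
  refine ⟨(Matrix.of fun k l : Fin d => (X (k, Fin.castLE hd l) :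
    MvPolynomial (Fin d × Fin n) ℂ)).det, fun h0 => ?_, fun a ha m hm => ?_⟩
  · have h1 := congrArg (eval fun q : Fin d × Fin n => if q.1.val = q.2.val then (1 : ℂ) else 0) h0
    rw [RingHom.map_det, map_zero] at h1
    refine one_ne_zero (h1.symm.trans ?_).symm
    rw [← Matrix.det_one (n := Fin d)]
    congr 1
    ext k l
    simp [Matrix.one_apply, Fin.ext_iff]
  · rw [RingHom.map_det] at ha
    have h1 : (a.submatrix id (Fin.castLE hd)).det ≠ 0 := by
      convert ha using 2
      ext k l
      simp
    have h2 := Matrix.linearIndependent_row_comp_of_det_ne_zero h1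
    have h3 : LinearIndependent ℂ (firstRows a hm).row :=
      h2.comp (Fin.castLE hm) (Fin.castLE_injective hm)
    rw [h3.rank_matrix, Fintype.card_fin]

/-- The conclusion of the theorem for a single generic polar variety. -/
theorem polarLocus_properties {i r : ℕ} (hsmooth : SregC F = zeroSetC F) (hd : p + d = n)
    {ε : ℂ} {a : Matrix (Fin d) (Fin n) ℂ}
    (hgen : PolarGeneric (fun t => map (algebraMap ℚ ℂ) (F t)) ε fun q => a q.1 q.2)
    (hm : m ≤ d) (hi : 1 ≤ i) (hmi : m + i = d + 1) (hr : r + 1 = p + m)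
    {W : Set (Fin n → ℂ)}
    (hW : W = zcl {x | x ∈ SregC F ∧ (polarMatrixAt F ε (firstRows a hm) x).rank ≤ r}) :
    W ⊆ zeroSetC F ∧ IsPureDim W (n - p - i) ∧
      IsIntegrallyClosed (MvPolynomial (Fin n) ℂ ⧸ vanishingIdeal ℂ W) ∧
      IsCMRing (MvPolynomial (Fin n) ℂ ⧸ vanishingIdeal ℂ W) := by
  have hdet := isGenericDeterminantal_polarMinorIdeal
    (fun P hP hFP => exists_det_pderiv_notMem hsmooth hP hFP) hgen hd hmi hi
  rw [hsmooth, ← zeroLocus_polarMinorIdeal ε a hm hr, zcl_zeroLocus] at hW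
  have hI := vanishingIdeal_zeroLocus_eq_radical (K := ℂ) (polarMinorIdeal
    (fun t => map (algebraMap ℚ ℂ) (F t)) ε (fun q => a q.1 q.2) m Set.univ)
  rw [hdet.isRadical.radical, ← hW] at hI
  refine ⟨?_, ?_, ?_, ?_⟩
  · rw [hW, zeroLocus_polarMinorIdeal ε a hm hr]
    exact fun x hx => hx.1
  · intro P hP
    rw [hI] at hP
    rw [hdet.ringKrullDim_quotient_eq hP, Nat.sub_sub]
    rfl
  · rw [hI]
    exact hdet.isIntegrallyClosed_quotient
  · rw [hI]
    exact hdet.isCMRing_quotient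

end PolarLocus

/-- Theorem 2 of the paper. Suppose `S` is smooth. Then there is a
nonempty Zariski open set `U` of complex `(n-p) × n` matrices such that for every
`a ∈ U` (all submatrices `a^{(i)}` of the first `n-p-i+1` rows having maximal rank) and
every `1 ≤ i ≤ n-p`, the generic polar varieties `W_{K(a^{(i)})}(S)` and
`W_{K̄(ā^{(i)})}(S)` are empty or normal Cohen–Macaulay subvarieties of `S` of pure
codimension `i` (i.e. pure dimension `n-p-i`); normality and Cohen–Macaulayness refer to
the reduced coordinate ring. -/
theorem statement4 {n p : ℕ} (hp1 : 1 ≤ p) (hpn : p ≤ n)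
    (F : Fin p → MvPolynomial (Fin n) ℚ)
    (hreg : IsRegSeq (List.ofFn F))
    (hrad : idealOfDef F)
    (hSne : (zeroSetC F).Nonempty)
    (hSdim : IsPureDim (zeroSetC F) (n - p))
    (hsmooth : SregC F = zeroSetC F) :
    ∃ U : Set (Matrix (Fin (n - p)) (Fin n) ℂ),
      U.Nonempty ∧ ZOpenMat U ∧
      ∀ a ∈ U, ∀ i, ∀ h1 : 1 ≤ i, ∀ h2 : i ≤ n - p,
        (firstRows a (by omega : n - p - i + 1 ≤ n - p)).rank = n - p - i + 1 ∧
        ∀ Wc Wd : Set (Fin n → ℂ),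
          Wc = Wclassic F (firstRows a (by omega : n - p - i + 1 ≤ n - p)) (n - i) →
          Wd = Wdual F (firstRows a (by omega : n - p - i + 1 ≤ n - p)) (n - i) →
          ((Wc = ∅ ∨
            (Wc ⊆ zeroSetC F ∧ IsPureDim Wc (n - p - i) ∧
             IsIntegrallyClosed (MvPolynomial (Fin n) ℂ ⧸ MvPolynomial.vanishingIdeal ℂ Wc) ∧
             IsCMRing (MvPolynomial (Fin n) ℂ ⧸ MvPolynomial.vanishingIdeal ℂ Wc))) ∧
           (Wd = ∅ ∨
            (Wd ⊆ zeroSetC F ∧ IsPureDim Wd (n - p - i) ∧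
             IsIntegrallyClosed (MvPolynomial (Fin n) ℂ ⧸ MvPolynomial.vanishingIdeal ℂ Wd) ∧
             IsCMRing (MvPolynomial (Fin n) ℂ ⧸ MvPolynomial.vanishingIdeal ℂ Wd)))) := by
  obtain ⟨f₀, hf₀, h₀⟩ := exists_polarGeneric (d := n - p)
    (fun t => map (algebraMap ℚ ℂ) (F t)) 0
  obtain ⟨f₁, hf₁, h₁⟩ := exists_polarGeneric (d := n - p)
    (fun t => map (algebraMap ℚ ℂ) (F t)) 1
  obtain ⟨f₂, hf₂, h₂⟩ := exists_rank_firstRows (Nat.sub_le n p)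
  have hf : f₀ * f₁ * f₂ ≠ 0 := mul_ne_zero (mul_ne_zero hf₀ hf₁) hf₂
  refine ⟨{a | eval (fun q => a q.1 q.2) (f₀ * f₁ * f₂) ≠ 0}, ?_,
    ⟨Ideal.span {f₀ * f₁ * f₂}, ?_⟩, ?_⟩
  · by_contra! hempty
    refine hf (MvPolynomial.funext fun x => ?_)
    by_contra hx
    have : Matrix.of (fun k l => x (k, l)) ∈
        {a : Matrix (Fin (n - p)) (Fin n) ℂ | eval (fun q => a q.1 q.2) (f₀ * f₁ * f₂) ≠ 0} := by
      simpa using hx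
    rwa [hempty] at this
  · ext a
    refine ⟨fun ha => ⟨_, Ideal.mem_span_singleton_self _, ha⟩, ?_⟩
    rintro ⟨g, hg, hga⟩
    obtain ⟨c, rfl⟩ := Ideal.mem_span_singleton'.1 hg
    rw [map_mul] at hga
    exact right_ne_zero_of_mul hga
  · intro a ha i hi hip
    rw [Set.mem_ofPred_eq, map_mul, map_mul] at ha
    have ha₀ := h₀ _ (left_ne_zero_of_mul (left_ne_zero_of_mul ha))
    have ha₁ := h₁ _ (right_ne_zero_of_mul (left_ne_zero_of_mul ha))
    refine ⟨h₂ a (right_ne_zero_of_mul ha) _ _, fun Wc Wd hWc hWd => ⟨Or.inr ?_, Or.inr ?_⟩⟩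
    · refine polarLocus_properties hsmooth (by omega) ha₀ (by omega : n - p - i + 1 ≤ n - p) hi
        (by omega) (r := n - i) (by omega) (hWc.trans ?_)
      simp only [Wclassic, polarMatrixAt, zero_mul, sub_zero]
      rfl
    · refine polarLocus_properties hsmooth (by omega) ha₁ (by omega : n - p - i + 1 ≤ n - p) hi
        (by omega) (r := n - i) (by omega) (hWd.trans ?_)
      simp only [Wdual, polarMatrixAt, one_mul]
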